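/- Exact location and order of zeros (Theorem on zeros): Let U be a tunnelling potential, consider the chiral model D(α), and assume dim_ℂ Ker_p(α) ≤ 1 for every p ∈ {0,1,2}. Set z_S := i/√3. Then: (a) every nonzero u ∈ Ker₀(α) satisfies u(z) = 0 if and only if z ∈ (z_S + Λ) ∪ (−z_S + Λ), and each zero is simple: for each z₀ ∈ (±z_S + Λ) there is a smooth w : ℂ → ℂ² with u(z) = (z − z₀)·w(z) and w(z₀) ≠ 0; (b) every nonzero u ∈ Ker₁(α) satisfies u(z) = 0 if and only if z ∈ Λ, and each zero has order exactly two: for each γ ∈ Λ there is a smooth w : ℂ → ℂ² with u(z) = (z − γ)²·w(z) and w(γ) ≠ 0. -/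

import Mathlib

noncomputable section

open Complex MeasureTheory

namespace TBG

/-- `ω = exp(2πi/3)`. -/
def ω : ℂ := Complex.exp (2 * Real.pi * Complex.I / 3)

/-- The moiré lattice `Λ = ℤω + ℤ ⊂ ℂ`. -/
def Λ : Set ℂ := {z : ℂ | ∃ m n : ℤ, z = m * ω + n}

/-- The dual lattice `Λ* = (4πi/√3)·Λ`. -/
def Λdual : Set ℂ := {p : ℂ | ∃ m n : ℤ, p = 4 * Real.pi * Complex.I / Real.sqrt 3 * (m * ω + n)}

/-- The high symmetry point `K = 4π/3`. -/
def K : ℂ := 4 * Real.pi / 3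

/-- `⟨z,w⟩ = Re (z · conj w)`. -/
def pair (z w : ℂ) : ℝ := (z * (starRingEnd ℂ) w).re

/-- `2 D_z̄ f = (1/i)(∂_x f + i ∂_y f)`. -/
def Dbar (f : ℂ → ℂ) (z : ℂ) : ℂ :=
  1 / Complex.I * (fderiv ℝ f z 1 + Complex.I * fderiv ℝ f z Complex.I)

/-- A tunnelling potential: smooth, with the translational and rotational symmetries. -/
def IsTunnelling (U : ℂ → ℂ) : Prop :=
  ContDiff ℝ (⊤ : ℕ∞) U ∧
    (∀ γ ∈ Λ, ∀ z : ℂ, U (z + γ) = Complex.exp (Complex.I * (pair γ K : ℂ)) * U z) ∧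
    ∀ z : ℂ, U (ω * z) = ω * U z

/-- Membership in `ker_{L²₀}(D(α)+k)` for the chiral model with tunnelling
potentials `U₊ = Up`, `U₋ = Um`: smooth solutions of `(D(α)+k)u = 0` with the
Floquet boundary conditions. -/
def InKer (Up Um : ℂ → ℂ) (α k : ℂ) (u : ℂ → ℂ × ℂ) : Prop :=
  ContDiff ℝ (⊤ : ℕ∞) u ∧
    (∀ z : ℂ, Dbar (fun w => (u w).1) z + k * (u z).1 + α * Up z * (u z).2 = 0) ∧
    (∀ z : ℂ, Dbar (fun w => (u w).2) z + k * (u z).2 + α * Um z * (u z).1 = 0) ∧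
    (∀ γ ∈ Λ, ∀ z : ℂ, (u (z + γ)).1 = Complex.exp (-Complex.I * (pair γ K : ℂ)) * (u z).1) ∧
    (∀ γ ∈ Λ, ∀ z : ℂ, (u (z + γ)).2 = Complex.exp (Complex.I * (pair γ K : ℂ)) * (u z).2)

/-- `Ker(α,k)` as a set of functions. -/
def kerSet (Up Um : ℂ → ℂ) (α k : ℂ) : Set (ℂ → ℂ × ℂ) := {u | InKer Up Um α k u}

/-- `dim_ℂ Ker(α,k)` (the set `Ker(α,k)` is a linear subspace, so the finrank of its span
is its dimension). -/
def kerDim (Up Um : ℂ → ℂ) (α k : ℂ) : ℕ :=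
  Module.finrank ℂ ↥(Submodule.span ℂ (kerSet Up Um α k))

/-- `Ker_p(α) = {u ∈ Ker(α,0) : u(ωz) = ω^(−p)·u(z)}`. -/
def kerPSet (Up Um : ℂ → ℂ) (α : ℂ) (p : ℕ) : Set (ℂ → ℂ × ℂ) :=
  {u | u ∈ kerSet Up Um α 0 ∧ ∀ z : ℂ, u (ω * z) = (ω ^ (-(p : ℤ))) • u z}

/-- `dim_ℂ Ker_p(α)`. -/
def kerPDim (Up Um : ℂ → ℂ) (α : ℂ) (p : ℕ) : ℕ :=
  Module.finrank ℂ ↥(Submodule.span ℂ (kerPSet Up Um α p))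

/-- `α` is magic: the flat band condition `Ker(α,k) ≠ {0}` for every `k`. -/
def IsMagic (Up Um : ℂ → ℂ) (α : ℂ) : Prop :=
  ∀ k : ℂ, ∃ u ∈ kerSet Up Um α k, u ≠ 0


/-- The stacking point `z_S = i/√3`. -/
def zS : ℂ := Complex.I / Real.sqrt 3

section

open scoped Topology
open Filter

lemma eq_of_eventually_punctured {E : Type*} [TopologicalSpace E] [T2Space E] {f g : ℂ → E}
    (hf : Continuous f) (hg : Continuous g) {z : ℂ} (h : ∀ᶠ x in 𝓝[≠] z, f x = g x) :
    f z = g z :=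
  tendsto_nhds_unique (((hf.tendsto z).mono_left nhdsWithin_le_nhds).congr' h)
    ((hg.tendsto z).mono_left nhdsWithin_le_nhds)

section Division

open scoped ContDiff

variable {E : Type} [NormedAddCommGroup E]

/-- A parametric integral over `[0, 1]` of a smooth function is smooth. -/
lemma contDiff_intervalIntegral_nat [NormedSpace ℝ E] {F : ℂ → ℝ → E}
    (hF : ContDiff ℝ ∞ (Function.uncurry F)) (n : ℕ) :
    ContDiff ℝ n fun z => ∫ t in (0 : ℝ)..1, F z t := by
  induction n generalizing E with
  | zero =>
    exact contDiff_zero.2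
      (intervalIntegral.continuous_parametric_intervalIntegral_of_continuous' hF.continuous _ _)
  | succ n ih =>
    have hF' : ContDiff ℝ ∞ (Function.uncurry fun z t => fderiv ℝ (fun y => F y t) z) :=
      ContDiff.fderiv (m := ∞) (f := fun (p : ℂ × ℝ) (y : ℂ) => F y p.2) (g := Prod.fst)
        (hF.comp (contDiff_snd.prodMk (contDiff_snd.comp contDiff_fst))) contDiff_fst (by simp)
    refine contDiff_succ_iff_hasFDerivAt.2
      ⟨fun z => ∫ t in (0 : ℝ)..1, fderiv ℝ (fun y => F y t) z, ih hF', fun z₀ => ?_⟩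
    obtain ⟨C, hC⟩ := ((isCompact_closedBall z₀ 1).prod
      (isCompact_Icc (a := (0 : ℝ)) (b := 1))).exists_bound_of_continuousOn
        hF'.continuous.continuousOn
    have hc (z : ℂ) : Continuous (F z) :=
      hF.continuous.comp (continuous_const.prodMk continuous_id)
    have hc' (z : ℂ) : Continuous fun t => fderiv ℝ (fun y => F y t) z :=
      hF'.continuous.comp (continuous_const.prodMk continuous_id)
    refine intervalIntegral.hasFDerivAt_integral_of_dominated_of_fderiv_le (𝕜 := ℝ)
      (F := F) (F' := fun z t => fderiv ℝ (fun y => F y t) z)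
      (bound := fun _ => C) (Metric.closedBall_mem_nhds z₀ one_pos)
      (.of_forall fun z => (hc z).aestronglyMeasurable)
      ((hc z₀).intervalIntegrable _ _) (hc' z₀).aestronglyMeasurable
      (.of_forall fun t ht z hz => ?_) intervalIntegrable_const (.of_forall fun t ht z hz => ?_)
    · rw [Set.uIoc_of_le zero_le_one] at ht
      exact hC (z, t) ⟨hz, ht.1.le, ht.2⟩
    · have : ContDiff ℝ ∞ fun y => F y t := hF.comp (contDiff_id.prodMk contDiff_const)
      exact (this.differentiable (by simp) z).hasFDerivAt

lemma contDiff_intervalIntegral [NormedSpace ℝ E] {F : ℂ → ℝ → E}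
    (hF : ContDiff ℝ ∞ (Function.uncurry F)) :
    ContDiff ℝ ∞ fun z => ∫ t in (0 : ℝ)..1, F z t :=
  contDiff_infty.2 (contDiff_intervalIntegral_nat hF)

/-- `conj z ^ n / z ^ m` is of class `C^k` as soon as `m + k + 1 ≤ n`. -/
lemma contDiff_conj_pow_div_pow (k m n : ℕ) (h : m + k + 1 ≤ n) :
    ContDiff ℝ k fun z : ℂ => (starRingEnd ℂ z) ^ n / z ^ m := by
  have hnorm (m n : ℕ) (h : m + 1 ≤ n) (z : ℂ) :
      ‖(starRingEnd ℂ z) ^ n / z ^ m‖ = ‖z‖ ^ (n - m) := by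
    rcases eq_or_ne z 0 with rfl | hz
    · simp [show n ≠ 0 by omega, show n - m ≠ 0 by omega]
    · rw [norm_div, norm_pow, norm_pow, RCLike.norm_conj, pow_sub₀ _ (by simpa) (by omega),
        div_eq_mul_inv]
  have hcont (m n : ℕ) (h : m + 1 ≤ n) : ContinuousAt (fun z : ℂ => (starRingEnd ℂ z) ^ n / z ^ m)
      0 := by
    have h0 : (starRingEnd ℂ 0) ^ n / (0 : ℂ) ^ m = 0 := by simp [show n ≠ 0 by omega]
    rw [ContinuousAt, h0, tendsto_zero_iff_norm_tendsto_zero]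
    simp_rw [hnorm m n h]
    have : Continuous fun z : ℂ => ‖z‖ ^ (n - m) := by fun_prop
    simpa [show n - m ≠ 0 by omega] using this.tendsto 0
  induction k generalizing m n with
  | zero =>
    refine contDiff_zero.2 (continuous_iff_continuousAt.2 fun z => ?_)
    rcases eq_or_ne z 0 with rfl | hz
    · exact hcont m n h
    · exact ((Complex.continuous_conj.pow n).continuousAt).div (continuousAt_id.pow m)
        (pow_ne_zero _ hz)
  | succ k ih =>
    refine contDiff_succ_iff_hasFDerivAt.2
      ⟨fun z => (n * ((starRingEnd ℂ z) ^ (n - 1) / z ^ m)) • (Complex.conjCLE : ℂ →L[ℝ] ℂ) -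
        (m * ((starRingEnd ℂ z) ^ n / z ^ (m + 1))) • (ContinuousLinearMap.id ℝ ℂ), ?_, fun z => ?_⟩
    · exact ((contDiff_const.mul (ih m (n - 1) (by omega))).smul contDiff_const).sub
        ((contDiff_const.mul (ih (m + 1) n (by omega))).smul contDiff_const)
    rcases eq_or_ne z 0 with rfl | hz
    · have hO : (fun z : ℂ => (starRingEnd ℂ z) ^ n / z ^ m) =O[𝓝 0]
          fun z => ‖z - 0‖ ^ (n - m) :=
        .of_bound 1 (.of_forall fun z => by rw [hnorm m n (by omega)]; simp)
      refine (hO.hasFDerivAt (𝕜 := ℝ) (by omega)).congr_fderiv (ContinuousLinearMap.ext fun v => ?_)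
      simp [show n - 1 ≠ 0 by omega, show n ≠ 0 by omega]
    · have h1 : HasFDerivAt (fun z : ℂ => (starRingEnd ℂ z) ^ n) _ z :=
        (Complex.conjCLE.hasFDerivAt (x := z)).pow n
      have h2 : HasFDerivAt (fun z : ℂ => (z ^ m)⁻¹) _ z :=
        (((hasDerivAt_pow m z).fun_inv (pow_ne_zero _ hz)).hasFDerivAt).restrictScalars ℝ
      refine (h1.mul h2).congr_fderiv (ContinuousLinearMap.ext fun v => ?_)
      simp
      rcases m with _ | m
      · simp
      · simp only [Nat.add_sub_cancel]
        field_simp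
        ring

variable [NormedSpace ℂ E]

/-- The Cauchy-Riemann operator `∂/∂x + i ∂/∂y`. -/
def cauchyRiemann (f : ℂ → E) (z : ℂ) : E := fderiv ℝ f z 1 + I • fderiv ℝ f z I

lemma cauchyRiemann_smul {f : ℂ → ℂ} {u : ℂ → E} {z : ℂ} (hf : DifferentiableAt ℂ f z)
    (hu : DifferentiableAt ℝ u z) :
    cauchyRiemann (fun z => f z • u z) z = f z • cauchyRiemann u z := by
  have h := (hf.hasFDerivAt.restrictScalars ℝ).fun_smul hu.hasFDerivAt
  have hI : I * I = -1 := I_mul_I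
  rw [cauchyRiemann, cauchyRiemann, h.fderiv]
  simp [smul_smul, mul_comm I, mul_assoc, hI]
  module

lemma continuous_cauchyRiemann {u : ℂ → E} (hu : ContDiff ℝ ∞ u) :
    Continuous (cauchyRiemann u) := by
  have := hu.continuous_fderiv (by simp)
  unfold cauchyRiemann
  fun_prop

lemma cauchyRiemann_comp_add_right (u : ℂ → E) (z a : ℂ) :
    cauchyRiemann (fun z => u (z + a)) z = cauchyRiemann u (z + a) := by
  simp [cauchyRiemann, fderiv_comp_add_right]

lemma _root_.Filter.EventuallyEq.cauchyRiemann {u v : ℂ → E} {z : ℂ} (h : u =ᶠ[𝓝 z] v) :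
    cauchyRiemann u z = cauchyRiemann v z := by
  simp [TBG.cauchyRiemann, h.fderiv_eq]

lemma fderiv_apply_eq (f : ℂ → E) (z v : ℂ) :
    fderiv ℝ f z v = v • ((1 / 2 : ℂ) • (fderiv ℝ f z 1 - I • fderiv ℝ f z I)) +
      (starRingEnd ℂ v) • ((1 / 2 : ℂ) • (fderiv ℝ f z 1 + I • fderiv ℝ f z I)) := by
  have h : fderiv ℝ f z v = (v.re : ℂ) • fderiv ℝ f z 1 + (v.im : ℂ) • fderiv ℝ f z I := by
    conv_lhs => rw [show v = v.re • (1 : ℂ) + v.im • I by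
      apply Complex.ext <;> simp]
    rw [map_add, map_smul, map_smul, Complex.coe_smul, Complex.coe_smul]
  rw [h, show (starRingEnd ℂ) v = v.re - v.im * I by
    apply Complex.ext <;> simp]
  conv_rhs => enter [1,1]; rw [← Complex.re_add_im v]
  simp only [smul_add, smul_sub, smul_smul]
  have hI : I * I = -1 := I_mul_I
  match_scalars
  · ring
  · linear_combination (v.im : ℂ) * hI

variable [CompleteSpace E]

lemma eq_integral_fderiv {u : ℂ → E} (hu : ContDiff ℝ ∞ u) (h0 : u 0 = 0) (z : ℂ) :
    u z = ∫ t in (0 : ℝ)..1, fderiv ℝ u (t * z) z := by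
  have h1 : ∀ t ∈ Set.uIcc (0 : ℝ) 1,
      HasDerivAt (fun t : ℝ => u (t * z)) (fderiv ℝ u (t * z) z) t := fun t _ => by
    have h2 : HasDerivAt (fun t : ℝ => (t : ℂ) * z) z t := by
      simpa using (Complex.ofRealCLM.hasDerivAt (x := t)).mul_const z
    exact ((hu.differentiable (by simp) (t * z)).hasFDerivAt).comp_hasDerivAt t h2
  rw [intervalIntegral.integral_eq_sub_of_hasDerivAt h1]
  · simp [h0]
  · apply Continuous.intervalIntegrable
    have := hu.continuous_fderiv (by simp)
    fun_prop

/-- Solutions of `∂̄u = A u` that vanish at the origin are, modulo `conj z ^ n`, divisible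
by `z`. -/
lemma exists_eq_smul_add_conj_pow_smul {u : ℂ → E} {A : ℂ → E →L[ℂ] E} (hu : ContDiff ℝ ∞ u)
    (hA : ContDiff ℝ ∞ A)
    (h : ∀ z, cauchyRiemann u z = A z (u z)) (h0 : u 0 = 0) (n : ℕ) :
    ∃ a b : ℂ → E, ContDiff ℝ ∞ a ∧ ContDiff ℝ ∞ b ∧
      ∀ z, u z = z • a z + (starRingEnd ℂ z) ^ n • b z := by
  induction n with
  | zero => exact ⟨0, u, contDiff_const, hu, by simp⟩
  | succ n ih =>
    obtain ⟨a, b, ha, hb, hab⟩ := ih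
    have hA' {c : ℂ → E} (hc : ContDiff ℝ ∞ c) (k : ℕ) :
        ContDiff ℝ ∞ (Function.uncurry fun (z : ℂ) (t : ℝ) =>
          ((1 / 2 : ℂ) * t ^ k) • A (t * z) (c (t * z))) := by
      have hs : ContDiff ℝ ∞ fun p : ℂ × ℝ => (p.2 : ℂ) * p.1 :=
        (Complex.ofRealCLM.contDiff.comp contDiff_snd).mul contDiff_fst
      have h1 : ContDiff ℝ ∞ fun p : ℂ × ℝ =>
          ((ContinuousLinearMap.restrictScalarsL ℂ E E ℝ ℝ) (A (p.2 * p.1))) :=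
        (ContinuousLinearMap.contDiff (𝕜 := ℝ)
          (ContinuousLinearMap.restrictScalarsL ℂ E E ℝ ℝ)).comp
          (hA.comp hs)
      exact (contDiff_const.mul ((Complex.ofRealCLM.contDiff.comp contDiff_snd).pow k)).smul
        (h1.clm_apply (hc.comp hs))
    have hd : ContDiff ℝ ∞ (Function.uncurry fun (z : ℂ) (t : ℝ) =>
        (1 / 2 : ℂ) • (fderiv ℝ u (t * z) 1 - I • fderiv ℝ u (t * z) I)) := by
      have hs : ContDiff ℝ ∞ fun p : ℂ × ℝ => (p.2 : ℂ) * p.1 :=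
        (Complex.ofRealCLM.contDiff.comp contDiff_snd).mul contDiff_fst
      have h1 (v : ℂ) : ContDiff ℝ ∞ fun p : ℂ × ℝ => fderiv ℝ u (p.2 * p.1) v :=
        ((hu.fderiv_right (m := ∞) (by simp)).comp hs).clm_apply contDiff_const
      exact ((h1 1).sub ((h1 I).const_smul I)).const_smul (1 / 2 : ℂ)
    refine ⟨fun z => (∫ t in (0 : ℝ)..1,
      (1 / 2 : ℂ) • (fderiv ℝ u (t * z) 1 - I • fderiv ℝ u (t * z) I)) +
        starRingEnd ℂ z • ∫ t in (0 : ℝ)..1, ((1 / 2 : ℂ) * t ^ 1) • A (t * z) (a (t * z)),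
      fun z => ∫ t in (0 : ℝ)..1, ((1 / 2 : ℂ) * t ^ n) • A (t * z) (b (t * z)), ?_, ?_, ?_⟩
    · exact (contDiff_intervalIntegral hd).add
        (Complex.conjCLE.contDiff.smul (contDiff_intervalIntegral (hA' ha 1)))
    · exact contDiff_intervalIntegral (hA' hb n)
    · intro z
      have hi {f : ℂ → ℝ → E} (hf : ContDiff ℝ ∞ (Function.uncurry f)) :
          IntervalIntegrable (f z) volume 0 1 :=
        (hf.continuous.comp (continuous_const.prodMk continuous_id)).intervalIntegrable _ _
      rw [eq_integral_fderiv hu h0 z, smul_add, ← intervalIntegral.integral_smul,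
        ← intervalIntegral.integral_smul, ← intervalIntegral.integral_smul,
        ← intervalIntegral.integral_smul, ← intervalIntegral.integral_add,
        ← intervalIntegral.integral_add]
      · refine intervalIntegral.integral_congr fun t _ => ?_
        rw [fderiv_apply_eq u, ← cauchyRiemann, h, hab (t * z)]
        simp only [map_add, map_smul, smul_add, map_mul, conj_ofReal, mul_pow]
        module
      · exact ((hi hd).smul _).add (((hi (hA' ha 1)).smul _).smul _)
      · exact (hi (hA' hb n)).smul _
      · exact (hi hd).smul _
      · exact ((hi (hA' ha 1)).smul _).smul _

lemma exists_eq_smul_of_eq_zero_aux {u : ℂ → E} {A : ℂ → E →L[ℂ] E} (hu : ContDiff ℝ ∞ u)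
    (hA : ContDiff ℝ ∞ A) (h : ∀ z, cauchyRiemann u z = A z (u z)) (h0 : u 0 = 0) :
    ∃ w : ℂ → E, ContDiff ℝ ∞ w ∧ ∀ z, u z = z • w z := by
  choose a b ha hb hab using exists_eq_smul_add_conj_pow_smul hu hA h h0
  have hq (n : ℕ) (z : ℂ) (hz : z ≠ 0) :
      z⁻¹ • u z = a n z + ((starRingEnd ℂ z) ^ n / z ^ 1) • b n z := by
    rw [hab n z, smul_add, smul_smul, smul_smul, inv_mul_cancel₀ hz, one_smul, pow_one,
      div_eq_inv_mul]
  have hlim (n : ℕ) (hn : 2 ≤ n) : Tendsto (fun z => z⁻¹ • u z) (𝓝[≠] 0) (𝓝 (a n 0)) := by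
    have h1 : Continuous fun z : ℂ => a n z + ((starRingEnd ℂ z) ^ n / z ^ 1) • b n z :=
      (ha n).continuous.add
        ((contDiff_conj_pow_div_pow 0 1 n hn).continuous.smul (hb n).continuous)
    have h2 := (h1.tendsto 0).mono_left (nhdsWithin_le_nhds (s := {0}ᶜ))
    simp only [show n ≠ 0 by omega, map_zero, ne_eq, not_false_eq_true, zero_pow, zero_div,
      zero_smul, add_zero] at h2
    refine h2.congr' ?_
    filter_upwards [self_mem_nhdsWithin] with z hz
    exact (hq n z hz).symm
  refine ⟨fun z => if z = 0 then a 2 0 else z⁻¹ • u z, contDiff_infty.2 fun k => ?_, fun z => ?_⟩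
  · have h1 : ContDiff ℝ k fun z : ℂ =>
        a (k + 2) z + ((starRingEnd ℂ z) ^ (k + 2) / z ^ 1) • b (k + 2) z :=
      (contDiff_infty.1 (ha _) k).add
        ((contDiff_conj_pow_div_pow k 1 (k + 2) (by omega)).smul (contDiff_infty.1 (hb _) k))
    convert h1 using 2 with z
    rcases eq_or_ne z 0 with rfl | hz
    · simpa using tendsto_nhds_unique (hlim 2 le_rfl) (hlim (k + 2) (by omega))
    · rw [if_neg hz, hq (k + 2) z hz]
  · rcases eq_or_ne z 0 with rfl | hz
    · simp [h0]
    · simp only [if_neg hz]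
      rw [smul_smul, mul_inv_cancel₀ hz, one_smul]

/-- A solution of `∂̄u = A u` that vanishes at `z₀` is smoothly divisible by `z - z₀`. -/
lemma exists_eq_smul_of_eq_zero {u : ℂ → E} {A : ℂ → E →L[ℂ] E} (hu : ContDiff ℝ ∞ u)
    (hA : ContDiff ℝ ∞ A) (h : ∀ z, cauchyRiemann u z = A z (u z)) {z₀ : ℂ} (h0 : u z₀ = 0) :
    ∃ w : ℂ → E, ContDiff ℝ ∞ w ∧ ∀ z, u z = (z - z₀) • w z := by
  have hs (a : ℂ) : ContDiff ℝ ∞ fun z : ℂ => z + a := contDiff_id.add contDiff_const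
  obtain ⟨w, hw, huw⟩ := exists_eq_smul_of_eq_zero_aux (u := fun z => u (z + z₀))
    (A := fun z => A (z + z₀)) (hu.comp (hs z₀)) (hA.comp (hs z₀))
    (fun z => by rw [cauchyRiemann_comp_add_right, h]) (by simpa using h0)
  exact ⟨fun z => w (z - z₀), by simpa [sub_eq_add_neg, Function.comp_def] using hw.comp (hs (-z₀)),
    fun z => by simpa using huw (z - z₀)⟩

end Division

section Kernel

/-- The zeroth order term of the chiral model. -/
def coupling (U : ℂ → ℂ) (α : ℂ) (z : ℂ) : ℂ × ℂ →L[ℂ] ℂ × ℂ :=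
  U z • ((-I * α) • (ContinuousLinearMap.inl ℂ ℂ ℂ ∘L ContinuousLinearMap.snd ℂ ℂ ℂ)) +
    U (-z) • ((-I * α) • (ContinuousLinearMap.inr ℂ ℂ ℂ ∘L ContinuousLinearMap.fst ℂ ℂ ℂ))

lemma contDiff_coupling {U : ℂ → ℂ} (hU : ContDiff ℝ (⊤ : ℕ∞) U) (α : ℂ) :
    ContDiff ℝ (⊤ : ℕ∞) (coupling U α) :=
  (hU.smul contDiff_const).add ((hU.comp contDiff_neg).smul contDiff_const)

@[simp] lemma coupling_apply (U : ℂ → ℂ) (α z : ℂ) (x : ℂ × ℂ) :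
    coupling U α z x = (-I * α * U z * x.2, -I * α * U (-z) * x.1) := by
  apply Prod.ext <;> simp [coupling] <;> ring

/-- The Floquet multiplier of a translation. -/
def floquet (γ : ℂ) : ℂ × ℂ →L[ℂ] ℂ × ℂ :=
  (exp (-I * (pair γ K : ℂ)) • ContinuousLinearMap.fst ℂ ℂ ℂ).prod
    (exp (I * (pair γ K : ℂ)) • ContinuousLinearMap.snd ℂ ℂ ℂ)

@[simp] lemma floquet_apply (γ : ℂ) (x : ℂ × ℂ) :
    floquet γ x = (exp (-I * (pair γ K : ℂ)) * x.1, exp (I * (pair γ K : ℂ)) * x.2) := rfl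

lemma cauchyRiemann_eq_prod {u : ℂ → ℂ × ℂ} (hu : ContDiff ℝ (⊤ : ℕ∞) u) (z : ℂ) :
    cauchyRiemann u z = (I * Dbar (fun w => (u w).1) z, I * Dbar (fun w => (u w).2) z) := by
  have h := (hu.differentiable (by simp) z).hasFDerivAt
  apply Prod.ext <;>
  simp [cauchyRiemann, Dbar, h.fst.fderiv, h.snd.fderiv] <;> ring_nf <;> simp

lemma mem_kerPSet_iff {U : ℂ → ℂ} {α : ℂ} {p : ℕ} {u : ℂ → ℂ × ℂ} :
    u ∈ kerPSet U (fun z => U (-z)) α p ↔ ContDiff ℝ (⊤ : ℕ∞) u ∧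
      (∀ z, cauchyRiemann u z = coupling U α z (u z)) ∧
      (∀ γ ∈ Λ, ∀ z, u (z + γ) = floquet γ (u z)) ∧
      ∀ z, u (ω * z) = (ω ^ (-(p : ℤ))) • u z := by
  constructor
  · rintro ⟨⟨h1, h2, h3, h4, h5⟩, h6⟩
    refine ⟨h1, fun z => ?_, fun γ hγ z => Prod.ext (h4 γ hγ z) (h5 γ hγ z), h6⟩
    rw [cauchyRiemann_eq_prod h1, coupling_apply]
    refine Prod.ext ?_ ?_
    · linear_combination I * h2 z
    · linear_combination I * h3 z
  · rintro ⟨h1, h2, h3, h4⟩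
    have h5 (z : ℂ) := h2 z
    simp only [cauchyRiemann_eq_prod h1, coupling_apply, Prod.ext_iff] at h5
    refine ⟨⟨h1, fun z => ?_, fun z => ?_, fun γ hγ z => congr_arg Prod.fst (h3 γ hγ z),
      fun γ hγ z => congr_arg Prod.snd (h3 γ hγ z)⟩, h4⟩
    · have := (h5 z).1
      linear_combination (-I) * this + (Dbar (fun w => (u w).1) z + α * U z * (u z).2) * I_mul_I
    · have := (h5 z).2
      linear_combination (-I) * this +
        (Dbar (fun w => (u w).2) z + α * U (-z) * (u z).1) * I_mul_I

/-- Smooth divisibility of `u` by `(z - s) ^ k`. -/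
def Vanish (u : ℂ → ℂ × ℂ) (s : ℂ) (k : ℕ) : Prop :=
  ∃ w : ℂ → ℂ × ℂ, ContDiff ℝ (⊤ : ℕ∞) w ∧ ∀ z, u z = (z - s) ^ k • w z

/-- A function that is smoothly extendable over each point agrees with a smooth function. -/
lemma exists_contDiff_of_forall_contDiffAt {F : ℂ → ℂ × ℂ}
    (h : ∀ s, ∃ W : ℂ → ℂ × ℂ, ContDiffAt ℝ (⊤ : ℕ∞) W s ∧ F =ᶠ[𝓝[≠] s] W) :
    ∃ v : ℂ → ℂ × ℂ, ContDiff ℝ (⊤ : ℕ∞) v ∧ ∀ s, F =ᶠ[𝓝[≠] s] v := by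
  choose W hW hF using h
  have hv (s : ℂ) : (fun z => W z z) =ᶠ[𝓝 s] W s := by
    have h1 : ∀ᶠ z in 𝓝 s, ContinuousAt (W s) z :=
      (((hW s).of_le (m := 1) (by simp)).eventually (by simp)).mono fun z hz => hz.continuousAt
    have h2 : ∀ᶠ z in 𝓝[≠] s, ∀ᶠ y in 𝓝 z, F y = W s y := by
      have := eventually_eventually_nhdsWithin.2 (hF s)
      filter_upwards [this, self_mem_nhdsWithin] with z hz hzs
      rwa [nhdsWithin_eq_nhds.2 (isOpen_compl_singleton.mem_nhds hzs)] at hz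
    have h3 : ∀ᶠ z in 𝓝[≠] s, W z z = W s z := by
      filter_upwards [h2, nhdsWithin_le_nhds h1] with z hz hc
      have hz' : W s =ᶠ[𝓝[≠] z] W z :=
        EventuallyEq.trans (nhdsWithin_le_nhds (hz.mono fun y hy => hy.symm)) (hF z)
      exact tendsto_nhds_unique ((hW z).continuousAt.mono_left nhdsWithin_le_nhds)
        ((hc.mono_left nhdsWithin_le_nhds).congr' hz')
    rw [eventually_nhdsWithin_iff] at h3
    filter_upwards [h3] with z hz
    rcases eq_or_ne z s with rfl | hzs
    · rfl
    · exact hz hzs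
  exact ⟨fun z => W z z, contDiff_iff_contDiffAt.2 fun s => (hW s).congr_of_eventuallyEq (hv s),
    fun s => (hF s).trans (nhdsWithin_le_nhds (hv s).symm)⟩

/-- Multiplying by a meromorphic function whose poles are compensated by zeros of `u`. -/
lemma exists_contDiff_eq_smul {u : ℂ → ℂ × ℂ} {f : ℂ → ℂ} (hf : ∀ s, MeromorphicAt f s)
    (hfu : ∀ s, ∃ k : ℕ, Vanish u s k ∧ -(k : ℤ) ≤ meromorphicOrderAt f s) :
    ∃ v : ℂ → ℂ × ℂ, ContDiff ℝ (⊤ : ℕ∞) v ∧ ∀ s, ∀ᶠ z in 𝓝[≠] s, v z = f z • u z := by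
  obtain ⟨v, hv, h⟩ := exists_contDiff_of_forall_contDiffAt (F := fun z => f z • u z) fun s => by
    obtain ⟨k, ⟨w, hw, huw⟩, hk⟩ := hfu s
    have hm : MeromorphicAt (fun z => (z - s) ^ k) s := by fun_prop
    have ho : 0 ≤ meromorphicOrderAt (f * fun z => (z - s) ^ k) s := by
      have h1 : meromorphicOrderAt (fun z : ℂ => (z - s) ^ k) s = (k : ℤ) :=
        (meromorphicOrderAt_eq_int_iff hm).2 ⟨1, analyticAt_const, by simp, by simp⟩
      rw [meromorphicOrderAt_mul (hf s) hm, h1]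
      calc (0 : WithTop ℤ) = ((-(k : ℤ) : ℤ) : WithTop ℤ) + ((k : ℤ) : WithTop ℤ) := by
            rw [← WithTop.coe_add]; simp
        _ ≤ _ := by gcongr; exact hk
    obtain ⟨g, hg, hfg⟩ := ((hf s).mul hm).meromorphicOrderAt_nonneg_iff.1 ho
    refine ⟨fun z => g z • w z, (hg.contDiffAt.restrict_scalars ℝ).smul hw.contDiffAt, ?_⟩
    filter_upwards [hfg] with z hz
    rw [← hz, huw z, smul_smul, Pi.mul_apply]
  exact ⟨v, hv, fun s => (h s).symm⟩

lemma exists_mem_kerPSet_eq_smul {U : ℂ → ℂ} (hU : ContDiff ℝ (⊤ : ℕ∞) U) {α : ℂ} {p q r : ℕ}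
    {u : ℂ → ℂ × ℂ} (hu : u ∈ kerPSet U (fun z => U (-z)) α p) {f : ℂ → ℂ}
    (hf : ∀ s, MeromorphicAt f s) (hper : ∀ γ ∈ Λ, ∀ z, f (z + γ) = f z)
    (hrot : ∀ z, f (ω * z) = ω ^ (-(q : ℤ)) * f z) (hω : ω ≠ 0)
    (hr : ω ^ (-(r : ℤ)) = ω ^ (-(q : ℤ)) * ω ^ (-(p : ℤ)))
    (hfu : ∀ s, ∃ k : ℕ, Vanish u s k ∧ -(k : ℤ) ≤ meromorphicOrderAt f s) :
    ∃ v ∈ kerPSet U (fun z => U (-z)) α r, ∀ s, ∀ᶠ z in 𝓝[≠] s, v z = f z • u z := by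
  obtain ⟨hu1, hu2, hu3, hu4⟩ := mem_kerPSet_iff.1 hu
  obtain ⟨v, hv, h⟩ := exists_contDiff_eq_smul hf hfu
  refine ⟨v, mem_kerPSet_iff.2 ⟨hv, fun s => ?_, fun γ hγ s => ?_, fun s => ?_⟩, h⟩
  · refine eq_of_eventually_punctured (continuous_cauchyRiemann hv)
      ((contDiff_coupling hU α).continuous.clm_apply hv.continuous) ?_
    have h1 : ∀ᶠ z in 𝓝[≠] s, ∀ᶠ y in 𝓝 z, v y = f y • u y := by
      filter_upwards [eventually_eventually_nhdsWithin.2 (h s), self_mem_nhdsWithin] with z hz hzs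
      rwa [nhdsWithin_eq_nhds.2 (isOpen_compl_singleton.mem_nhds hzs)] at hz
    filter_upwards [h1, (hf s).eventually_analyticAt] with z hz hfz
    rw [EventuallyEq.cauchyRiemann hz, cauchyRiemann_smul hfz.differentiableAt
      (hu1.differentiable (by simp) z), hu2, hz.self_of_nhds, map_smul]
  · have hs : Continuous fun z : ℂ => z + γ := by fun_prop
    have ht : Tendsto (fun z : ℂ => z + γ) (𝓝[≠] s) (𝓝[≠] (s + γ)) :=
      tendsto_nhdsWithin_iff.2 ⟨(hs.tendsto s).mono_left nhdsWithin_le_nhds, by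
        filter_upwards [self_mem_nhdsWithin] with z hz
        simpa using hz⟩
    refine eq_of_eventually_punctured (hv.continuous.comp hs)
      ((floquet γ).continuous.comp hv.continuous) ?_
    filter_upwards [h s, ht.eventually (h (s + γ))] with z h1 h2
    simp only [Function.comp_apply]
    rw [h2, h1, hper γ hγ, hu3 γ hγ, map_smul]
  · have hs : Continuous fun z : ℂ => ω * z := by fun_prop
    have ht : Tendsto (fun z : ℂ => ω * z) (𝓝[≠] s) (𝓝[≠] (ω * s)) :=
      tendsto_nhdsWithin_iff.2 ⟨(hs.tendsto s).mono_left nhdsWithin_le_nhds, by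
        filter_upwards [self_mem_nhdsWithin] with z hz
        simpa [hω] using hz⟩
    refine eq_of_eventually_punctured (hv.continuous.comp hs)
      (hv.continuous.const_smul (ω ^ (-(r : ℤ)))) ?_
    filter_upwards [h s, ht.eventually (h (ω * s))] with z h1 h2
    simp only [Function.comp_apply, Pi.smul_apply]
    rw [h2, h1, hrot, hu4, smul_smul, smul_smul, hr]
    ring_nf

end Kernel

section Lattice

lemma omega_eq : ω = -1 / 2 + Real.sqrt 3 / 2 * I := by
  have h : (2 * Real.pi * I / 3 : ℂ) = ((Real.pi - Real.pi / 3 : ℝ) : ℂ) * I := by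
    push_cast; ring
  rw [ω, h, exp_mul_I, ← ofReal_cos, ← ofReal_sin, Real.cos_pi_sub, Real.sin_pi_sub,
    Real.cos_pi_div_three, Real.sin_pi_div_three]
  push_cast; ring

lemma omega_re : ω.re = -1 / 2 := by simp [omega_eq]

lemma omega_im : ω.im = Real.sqrt 3 / 2 := by
  simp [omega_eq]

lemma omega_sq : ω ^ 2 = -1 - ω := by
  have h3 : (Real.sqrt 3 : ℂ) ^ 2 = 3 := by
    rw [← ofReal_pow, Real.sq_sqrt (by norm_num)]; norm_num
  rw [omega_eq]
  linear_combination (Real.sqrt 3 / 2 : ℂ) ^ 2 * I_sq - h3 / 4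

lemma omega_pow_three : ω ^ 3 = 1 := by
  linear_combination (ω - 1) * omega_sq

lemma omega_ne_zero : ω ≠ 0 := exp_ne_zero _

lemma omega_ne_one : ω ≠ 1 := fun h => by
  have := omega_re
  rw [h] at this
  norm_num at this

lemma omega_sq_ne_one : ω ^ 2 ≠ 1 := fun h => by
  have h1 := omega_sq
  have h2 := congr_arg re (h.symm.trans h1)
  simp [omega_re] at h2
  norm_num at h2

lemma eq_zero_of_mul_omega_add_eq_zero {a b : ℝ} (h : (a * ω + b : ℂ) = 0) : a = 0 ∧ b = 0 := by
  have h1 := congr_arg im h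
  have h2 := congr_arg re h
  simp [omega_im, omega_re] at h1 h2
  subst h1
  simpa using h2

lemma add_mem_lattice {a b : ℂ} (ha : a ∈ Λ) (hb : b ∈ Λ) : a + b ∈ Λ := by
  obtain ⟨m, n, rfl⟩ := ha
  obtain ⟨k, l, rfl⟩ := hb
  exact ⟨m + k, n + l, by push_cast; ring⟩

lemma neg_mem_lattice {a : ℂ} (ha : a ∈ Λ) : -a ∈ Λ := by
  obtain ⟨m, n, rfl⟩ := ha
  exact ⟨-m, -n, by push_cast; ring⟩

lemma sub_mem_lattice {a b : ℂ} (ha : a ∈ Λ) (hb : b ∈ Λ) : a - b ∈ Λ :=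
  sub_eq_add_neg a b ▸ add_mem_lattice ha (neg_mem_lattice hb)

lemma neg_mem_lattice_iff {a : ℂ} : -a ∈ Λ ↔ a ∈ Λ :=
  ⟨fun h => by simpa using neg_mem_lattice h, neg_mem_lattice⟩

lemma omega_mul_mem_lattice {a : ℂ} (ha : a ∈ Λ) : ω * a ∈ Λ := by
  obtain ⟨m, n, rfl⟩ := ha
  refine ⟨n - m, -m, ?_⟩
  push_cast
  linear_combination (m : ℂ) * omega_sq

lemma omega_mul_mem_lattice_iff {a : ℂ} : ω * a ∈ Λ ↔ a ∈ Λ := by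
  refine ⟨fun h => ?_, omega_mul_mem_lattice⟩
  have := omega_mul_mem_lattice (omega_mul_mem_lattice h)
  rwa [← mul_assoc, ← mul_assoc, ← pow_two, ← pow_succ, omega_pow_three, one_mul] at this

lemma zero_mem_lattice : (0 : ℂ) ∈ Λ := ⟨0, 0, by simp⟩

lemma neg_one_sub_omega_mem_lattice : -1 - ω ∈ Λ := ⟨-1, -1, by push_cast; ring⟩

lemma three_mul_zS : 3 * zS = 1 + 2 * ω := by
  have h3 : (Real.sqrt 3 : ℂ) ^ 2 = 3 := by
    rw [← ofReal_pow, Real.sq_sqrt (by norm_num)]; norm_num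
  have h0 : (Real.sqrt 3 : ℂ) ≠ 0 := by simp
  rw [omega_eq, zS]
  field_simp
  linear_combination -I * h3

lemma omega_mul_zS : ω * zS = zS + (-1 - ω) := by
  have h := three_mul_zS
  have h3 : (3 : ℂ) ≠ 0 := by norm_num
  apply mul_left_cancel₀ h3
  linear_combination (ω - 1) * h + 2 * omega_sq

lemma not_mem_lattice_of_three_mul {a : ℂ} {k : ℤ} (h : 3 * a = k * (1 + 2 * ω))
    (hk : ¬ (3 : ℤ) ∣ k) : a ∉ Λ := by
  rintro ⟨m, n, rfl⟩
  obtain ⟨-, h2⟩ := eq_zero_of_mul_omega_add_eq_zero (a := 3 * m - 2 * k) (b := 3 * n - k) (by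
    push_cast; linear_combination h)
  have h2' : 3 * n = k := by
    have : (3 * n : ℝ) = k := by linarith
    exact_mod_cast this
  exact hk ⟨n, h2'.symm⟩

lemma zS_not_mem_lattice : zS ∉ Λ :=
  not_mem_lattice_of_three_mul (k := 1) (by push_cast; linear_combination three_mul_zS)
    (by norm_num)

lemma two_mul_zS_not_mem_lattice : zS + zS ∉ Λ :=
  not_mem_lattice_of_three_mul (k := 2) (by push_cast; linear_combination 2 * three_mul_zS)
    (by norm_num)

end Lattice

section Zeros

variable {U : ℂ → ℂ} {α : ℂ} {p : ℕ} {u : ℂ → ℂ × ℂ}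

lemma vanish_zero (hu : ContDiff ℝ (⊤ : ℕ∞) u) (s : ℂ) : Vanish u s 0 := ⟨u, hu, by simp⟩

lemma Vanish.apply_eq_zero {s : ℂ} {k : ℕ} (h : Vanish u s k) (hk : k ≠ 0) : u s = 0 := by
  obtain ⟨w, -, h⟩ := h
  rw [h, sub_self, zero_pow hk, zero_smul]

lemma smul_right_cancel_of_continuous {f g : ℂ → ℂ × ℂ} (hf : Continuous f) (hg : Continuous g)
    {s : ℂ} {k : ℕ} (h : ∀ z, (z - s) ^ k • f z = (z - s) ^ k • g z) (z : ℂ) : f z = g z := by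
  have h1 (z : ℂ) (hz : z ≠ s) : f z = g z :=
    smul_right_injective _ (pow_ne_zero k (sub_ne_zero.2 hz)) (h z)
  rcases eq_or_ne z s with rfl | hz
  · exact eq_of_eventually_punctured hf hg (eventually_mem_nhdsWithin.mono fun x hx => h1 x hx)
  · exact h1 z hz

lemma Vanish.succ (hU : ContDiff ℝ (⊤ : ℕ∞) U) (hu : u ∈ kerPSet U (fun z => U (-z)) α p)
    {s : ℂ} {k : ℕ} {w : ℂ → ℂ × ℂ} (hw : ContDiff ℝ (⊤ : ℕ∞) w)
    (h : ∀ z, u z = (z - s) ^ k • w z) (h0 : w s = 0) : Vanish u s (k + 1) := by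
  obtain ⟨hu1, hu2, -⟩ := mem_kerPSet_iff.1 hu
  have hcr (z : ℂ) : cauchyRiemann w z = coupling U α z (w z) := by
    refine smul_right_cancel_of_continuous (continuous_cauchyRiemann hw)
      ((contDiff_coupling hU α).continuous.clm_apply hw.continuous) (s := s) (k := k) ?_ z
    intro z
    rw [← map_smul, ← h, ← hu2, funext h, cauchyRiemann_smul (by fun_prop)
      (hw.differentiable (by simp) z)]
  obtain ⟨v, hv, hwv⟩ := exists_eq_smul_of_eq_zero hw (contDiff_coupling hU α) hcr h0
  exact ⟨v, hv, fun z => by rw [h, hwv, smul_smul, pow_succ]⟩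

lemma vanish_one (hU : ContDiff ℝ (⊤ : ℕ∞) U) (hu : u ∈ kerPSet U (fun z => U (-z)) α p)
    {s : ℂ} (h : u s = 0) : Vanish u s 1 :=
  Vanish.succ (k := 0) hU hu (mem_kerPSet_iff.1 hu).1 (by simp) h

lemma Vanish.add_mem_lattice (hu : u ∈ kerPSet U (fun z => U (-z)) α p) {s γ : ℂ} {k : ℕ}
    (h : Vanish u s k) (hγ : γ ∈ Λ) : Vanish u (s + γ) k := by
  obtain ⟨w, hw, h⟩ := h
  refine ⟨fun z => floquet γ (w (z - γ)), ((floquet γ).restrictScalars ℝ).contDiff.comp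
    (hw.comp (contDiff_id.sub contDiff_const)), fun z => ?_⟩
  have := (mem_kerPSet_iff.1 hu).2.2.1 γ hγ (z - γ)
  rw [sub_add_cancel] at this
  rw [this, h, map_smul]
  ring_nf

lemma apply_mul_omega_inv (hu : u ∈ kerPSet U (fun z => U (-z)) α p) (z : ℂ) :
    u z = (ω ^ (-(p : ℤ))) • u (ω⁻¹ * z) := by
  rw [← (mem_kerPSet_iff.1 hu).2.2.2, mul_inv_cancel_left₀ omega_ne_zero]

lemma Vanish.omega_mul (hu : u ∈ kerPSet U (fun z => U (-z)) α p) {s : ℂ} {k : ℕ}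
    (h : Vanish u s k) : Vanish u (ω * s) k := by
  obtain ⟨w, hw, h⟩ := h
  refine ⟨fun z => (ω ^ (-(p : ℤ)) * ω⁻¹ ^ k) • w (ω⁻¹ * z),
    ContDiff.const_smul (f := fun z => w (ω⁻¹ * z)) _
      (hw.comp (contDiff_const.mul contDiff_id)), fun z => ?_⟩
  rw [apply_mul_omega_inv hu z, h, smul_smul, smul_smul,
    show ω⁻¹ * z - s = ω⁻¹ * (z - ω * s) by
      rw [mul_sub, inv_mul_cancel_left₀ omega_ne_zero], mul_pow]
  ring_nf

lemma Vanish.succ_zero (hU : ContDiff ℝ (⊤ : ℕ∞) U) (hu : u ∈ kerPSet U (fun z => U (-z)) α p)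
    {k : ℕ} (h : Vanish u 0 k) (hk : ω ^ (p + k) ≠ 1) : Vanish u 0 (k + 1) := by
  obtain ⟨w, hw, h⟩ := h
  refine Vanish.succ hU hu hw h ?_
  have h1 (z : ℂ) : (ω ^ (p + k)) • w (ω * z) = w z := by
    refine smul_right_cancel_of_continuous (f := fun z => (ω ^ (p + k)) • w (ω * z)) (k := k)
      (s := 0) (by have := hw.continuous; fun_prop)
      hw.continuous (fun z => ?_) z
    have h2 := (mem_kerPSet_iff.1 hu).2.2.2 z
    rw [h, h z, sub_zero, mul_pow] at h2
    have h3 := congr_arg (fun x => ω ^ p • x) h2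
    simp only [smul_smul, sub_zero, zpow_neg, zpow_natCast] at h3 ⊢
    rw [mul_inv_cancel_left₀ (pow_ne_zero _ omega_ne_zero)] at h3
    rw [← h3, pow_add]
    ring_nf
  have h4 := h1 0
  rw [mul_zero] at h4
  have h5 : (ω ^ (p + k) - 1) • w 0 = 0 := by rw [sub_smul, h4, one_smul, sub_self]
  exact (smul_eq_zero.1 h5).resolve_left (sub_ne_zero.2 hk)

lemma apply_add_eq_zero (hu : u ∈ kerPSet U (fun z => U (-z)) α p) {s γ : ℂ} (h : u s = 0)
    (hγ : γ ∈ Λ) : u (s + γ) = 0 := by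
  rw [(mem_kerPSet_iff.1 hu).2.2.1 γ hγ, h, map_zero]

lemma eq_zero_of_omega_mul_eq (hu : u ∈ kerPSet U (fun z => U (-z)) α 0) {s γ : ℂ} (hγ : γ ∈ Λ)
    (h : ω * s = s + γ) (h1 : exp (I * (pair γ K : ℂ)) ≠ 1) : u s = 0 := by
  have h2 := (mem_kerPSet_iff.1 hu).2.2.2 s
  rw [h, (mem_kerPSet_iff.1 hu).2.2.1 γ hγ, floquet_apply, Prod.ext_iff] at h2
  have h1' : exp (-I * (pair γ K : ℂ)) ≠ 1 := by
    rw [neg_mul, exp_neg]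
    simpa using h1
  simp only [Nat.cast_zero, neg_zero, zpow_zero, one_smul] at h2
  exact Prod.ext ((mul_left_eq_self₀.1 h2.1).resolve_left h1')
    ((mul_left_eq_self₀.1 h2.2).resolve_left h1)

lemma pair_neg_one_sub_omega : pair (-1 - ω) K = -(2 * Real.pi / 3) := by
  have : (K : ℂ) = ((4 * Real.pi / 3 : ℝ) : ℂ) := by simp [K]
  rw [pair, this, conj_ofReal, re_mul_ofReal]
  simp [omega_re]
  ring

lemma pair_neg (γ : ℂ) : pair (-γ) K = -pair γ K := by simp [pair]

lemma apply_zS_eq_zero (hu : u ∈ kerPSet U (fun z => U (-z)) α 0) : u zS = 0 := by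
  refine eq_zero_of_omega_mul_eq hu neg_one_sub_omega_mem_lattice omega_mul_zS ?_
  rw [pair_neg_one_sub_omega, show I * ((-(2 * Real.pi / 3) : ℝ) : ℂ) = -(2 * Real.pi * I / 3) by
    push_cast; ring, exp_neg, ← ω]
  simpa using omega_ne_one

lemma apply_neg_zS_eq_zero (hu : u ∈ kerPSet U (fun z => U (-z)) α 0) : u (-zS) = 0 := by
  refine eq_zero_of_omega_mul_eq hu (neg_mem_lattice neg_one_sub_omega_mem_lattice)
    (by linear_combination -omega_mul_zS) ?_
  rw [pair_neg, pair_neg_one_sub_omega, show I * ((-(-(2 * Real.pi / 3)) : ℝ) : ℂ) =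
    2 * Real.pi * I / 3 by push_cast; ring, ← ω]
  exact omega_ne_one

/-- The symmetry `u ↦ (u₂(-z), -u₁(-z))`. -/
def flip (u : ℂ → ℂ × ℂ) (z : ℂ) : ℂ × ℂ := ((u (-z)).2, -(u (-z)).1)

lemma flip_mem_kerPSet (hu : u ∈ kerPSet U (fun z => U (-z)) α p) :
    flip u ∈ kerPSet U (fun z => U (-z)) α p := by
  obtain ⟨h1, h2, h3, h4⟩ := mem_kerPSet_iff.1 hu
  have hn : ContDiff ℝ (⊤ : ℕ∞) fun z => u (-z) := h1.comp contDiff_neg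
  refine mem_kerPSet_iff.2 ⟨hn.snd.prodMk hn.fst.neg, fun z => ?_, fun γ hγ z => ?_, fun z => ?_⟩
  · have h5 : HasFDerivAt (fun z => u (-z)) _ z :=
      (h1.differentiable (by simp) (-z)).hasFDerivAt.comp z (hasFDerivAt_id z).neg
    have h6 : HasFDerivAt (flip u) _ z := h5.snd.prodMk h5.fst.neg
    have h7 := h2 (-z)
    simp only [coupling_apply, cauchyRiemann, neg_neg, Prod.ext_iff, Prod.fst_add, Prod.snd_add,
      Prod.smul_fst, Prod.smul_snd, smul_eq_mul] at h7
    rw [cauchyRiemann, h6.fderiv, coupling_apply]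
    refine Prod.ext ?_ ?_
    · simp [flip]
      linear_combination -h7.2
    · simp [flip]
      linear_combination h7.1
  · have := h3 (-γ) (neg_mem_lattice hγ) (-z)
    rw [← neg_add_rev, add_comm γ z] at this
    simp only [flip, this, floquet_apply, pair_neg]
    simp
  · rw [flip, ← mul_neg, h4, flip]
    simp

lemma vanish_flip {s : ℂ} {k : ℕ} (h : Vanish u s k) : Vanish (flip u) (-s) k := by
  obtain ⟨w, hw, h⟩ := h
  have hn : ContDiff ℝ (⊤ : ℕ∞) fun z => w (-z) := hw.comp contDiff_neg
  refine ⟨fun z => (-1 : ℂ) ^ k • flip w z, ContDiff.const_smul (f := flip w) _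
    (hn.snd.prodMk hn.fst.neg),
    fun z => ?_⟩
  beta_reduce
  rw [flip, h, smul_smul, ← mul_pow, show (z - -s) * -1 = -z - s by ring, flip]
  simp

lemma flip_ne_zero (h : u ≠ 0) : flip u ≠ 0 := fun h0 => h <| funext fun z => by
  have := congr_fun h0 (-z)
  simp only [flip, neg_neg, Pi.zero_apply, Prod.mk_eq_zero, neg_eq_zero] at this
  exact Prod.ext this.2 this.1

end Zeros

section Elliptic

/-- The period pair of the moiré lattice. -/
def periods : PeriodPair where
  ω₁ := ω
  ω₂ := 1
  indep := by
    rw [LinearIndependent.pair_iff]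
    intro a b h
    exact eq_zero_of_mul_omega_add_eq_zero (by simpa using h)

lemma mem_periods_lattice {z : ℂ} : z ∈ periods.lattice ↔ z ∈ Λ := by
  rw [PeriodPair.mem_lattice]
  simp only [periods, mul_one, Λ, Set.mem_ofPred_eq, eq_comm]

/-- The Weierstrass function of `Λ`. -/
def wp : ℂ → ℂ := periods.weierstrassP

/-- The derivative of the Weierstrass function of `Λ`. -/
def wpd : ℂ → ℂ := periods.derivWeierstrassP

lemma deriv_wp : deriv wp = wpd := periods.deriv_weierstrassP

lemma wp_add {γ : ℂ} (hγ : γ ∈ Λ) (z : ℂ) : wp (z + γ) = wp z :=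
  periods.weierstrassP_add_coe z ⟨γ, mem_periods_lattice.2 hγ⟩

lemma wpd_add {γ : ℂ} (hγ : γ ∈ Λ) (z : ℂ) : wpd (z + γ) = wpd z :=
  periods.derivWeierstrassP_add_coe z ⟨γ, mem_periods_lattice.2 hγ⟩

lemma wp_neg (z : ℂ) : wp (-z) = wp z := periods.weierstrassP_neg z

lemma wpd_neg (z : ℂ) : wpd (-z) = -wpd z := periods.derivWeierstrassP_neg z

lemma meromorphicAt_wp (z : ℂ) : MeromorphicAt wp z := periods.meromorphic_weierstrassP z

lemma meromorphicAt_wpd (z : ℂ) : MeromorphicAt wpd z := periods.meromorphic_derivWeierstrassP z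

lemma analyticAt_wp {z : ℂ} (hz : z ∉ Λ) : AnalyticAt ℂ wp z :=
  periods.analyticOnNhd_weierstrassP z fun h => hz (mem_periods_lattice.1 h)

lemma analyticAt_wpd {z : ℂ} (hz : z ∉ Λ) : AnalyticAt ℂ wpd z :=
  periods.analyticOnNhd_derivWeierstrassP z fun h => hz (mem_periods_lattice.1 h)

lemma order_wp {z : ℂ} (hz : z ∈ Λ) : meromorphicOrderAt wp z = -2 :=
  periods.order_weierstrassP z (mem_periods_lattice.2 hz)

lemma order_wpd {z : ℂ} (hz : z ∈ Λ) : meromorphicOrderAt wpd z = ((-3 : ℤ) : WithTop ℤ) := by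
  rw [← deriv_wp]
  exact meromorphicOrderAt_deriv_eq_sub_one (n := -2) (by norm_num) (order_wp hz)

/-- Multiplication by `ω` as a permutation of the lattice. -/
def omegaEquiv : periods.lattice ≃ periods.lattice :=
  (Equiv.mulLeft₀ ω omega_ne_zero).subtypeEquiv fun a => by
    change a ∈ periods.lattice ↔ ω * a ∈ periods.lattice
    rw [mem_periods_lattice, mem_periods_lattice, omega_mul_mem_lattice_iff]

lemma omegaEquiv_coe (l : periods.lattice) : (omegaEquiv l : ℂ) = ω * l := rfl

lemma wp_omega_mul (z : ℂ) : wp (ω * z) = ω ^ (-(2 : ℕ) : ℤ) * wp z := by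
  rw [wp, PeriodPair.weierstrassP, PeriodPair.weierstrassP, ← omegaEquiv.tsum_eq, ← tsum_mul_left]
  congr 1 with l
  rw [omegaEquiv_coe, ← mul_sub, mul_pow, mul_pow, zpow_neg, zpow_natCast]
  simp only [one_div, mul_inv]
  ring

lemma wpd_omega_mul (z : ℂ) : wpd (ω * z) = ω ^ (-(0 : ℕ) : ℤ) * wpd z := by
  rw [wpd, PeriodPair.derivWeierstrassP, PeriodPair.derivWeierstrassP, ← omegaEquiv.tsum_eq]
  simp only [omegaEquiv_coe, ← mul_sub, mul_pow, omega_pow_three]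
  simp

lemma periods_g₂ : periods.g₂ = 0 := by
  have h : periods.G 4 = ω⁻¹ * periods.G 4 := by
    conv_lhs => rw [PeriodPair.G, ← omegaEquiv.tsum_eq]
    rw [PeriodPair.G, ← tsum_mul_left]
    congr 1 with l
    rw [omegaEquiv_coe, mul_pow, mul_inv, show ω ^ 4 = ω by
      linear_combination ω * omega_pow_three]
  have h2 : (1 - ω⁻¹) * periods.G 4 = 0 := by linear_combination h
  have h3 : 1 - ω⁻¹ ≠ 0 := by
    rw [sub_ne_zero, ne_comm, inv_ne_one]
    exact omega_ne_one
  rw [PeriodPair.g₂, (mul_eq_zero.1 h2).resolve_left h3, mul_zero]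

lemma wpd_sq {z : ℂ} (hz : z ∉ Λ) : wpd z ^ 2 = 4 * wp z ^ 3 - periods.g₃ := by
  have := periods.derivWeierstrassP_sq z fun h => hz (mem_periods_lattice.1 h)
  rw [periods_g₂] at this
  rw [wpd, this, wp]
  ring

lemma isOpen_compl_lattice : IsOpen Λᶜ := by
  have : (periods.lattice : Set ℂ) = Λ := Set.ext fun z => mem_periods_lattice
  rw [← this]
  exact periods.isClosed_lattice.isOpen_compl

lemma order_ne_top_of_order_ne_top {f : ℂ → ℂ} (hf : ∀ z, MeromorphicAt f z) {x : ℂ}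
    (hx : meromorphicOrderAt f x ≠ ⊤) (y : ℂ) : meromorphicOrderAt f y ≠ ⊤ :=
  MeromorphicOn.meromorphicOrderAt_ne_top_of_isPreconnected (U := Set.univ) (fun z _ => hf z)
    isPreconnected_univ (Set.mem_univ x) (Set.mem_univ y) hx

lemma order_wpd_ne_top (z : ℂ) : meromorphicOrderAt wpd z ≠ ⊤ :=
  order_ne_top_of_order_ne_top meromorphicAt_wpd (x := 0)
    (by rw [order_wpd zero_mem_lattice]; exact WithTop.coe_ne_top) z

lemma deriv_wpd {z : ℂ} (hz : z ∉ Λ) : deriv wpd z = 6 * wp z ^ 2 := by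
  have hev : ∀ᶠ x in 𝓝 z, wpd x * (deriv wpd x - 6 * wp x ^ 2) = 0 := by
    filter_upwards [isOpen_compl_lattice.mem_nhds hz] with x hx
    have h1 := (analyticAt_wpd hx).differentiableAt.hasDerivAt
    have h2 := (analyticAt_wp hx).differentiableAt.hasDerivAt
    rw [deriv_wp] at h2
    have h3 : (fun y => wpd y ^ 2) =ᶠ[𝓝 x] fun y => 4 * wp y ^ 3 - periods.g₃ := by
      filter_upwards [isOpen_compl_lattice.mem_nhds hx] with y hy using wpd_sq hy
    have h4 := (h1.fun_pow 2).unique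
      ((((h2.fun_pow 3).const_mul 4).sub_const _).congr_of_eventuallyEq h3)
    simp only [Nat.cast_ofNat] at h4
    linear_combination h4 / 2
  have han : AnalyticAt ℂ (fun x => deriv wpd x - 6 * wp x ^ 2) z :=
    (analyticAt_wpd hz).deriv.sub (analyticAt_const.mul ((analyticAt_wp hz).pow 2))
  have htop : meromorphicOrderAt (wpd * fun x => deriv wpd x - 6 * wp x ^ 2) z = ⊤ :=
    meromorphicOrderAt_eq_top_iff.2 (nhdsWithin_le_nhds hev)
  rw [meromorphicOrderAt_mul (meromorphicAt_wpd z) han.meromorphicAt, WithTop.add_eq_top] at htop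
  have h5 := meromorphicOrderAt_eq_top_iff.1 (htop.resolve_left (order_wpd_ne_top z))
  have h6 := tendsto_nhds_unique
    ((han.continuousAt.tendsto.mono_left nhdsWithin_le_nhds).congr' h5) tendsto_const_nhds
  linear_combination h6

end Elliptic

section EllipticZeros

/-- A solution of `f'' = c f` with vanishing Cauchy data vanishes. -/
lemma order_eq_top_of_deriv_deriv_eq {f c : ℂ → ℂ} {x : ℂ} (hf : AnalyticAt ℂ f x)
    (hc : AnalyticAt ℂ c x) (h0 : f x = 0) (h1 : deriv f x = 0)
    (h : ∀ᶠ z in 𝓝 x, deriv (deriv f) z = c z * f z) : meromorphicOrderAt f x = ⊤ := by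
  by_contra htop
  obtain ⟨n, hn⟩ := WithTop.ne_top_iff_exists.1 htop
  have hpos {g : ℂ → ℂ} {m : ℤ} (hg : AnalyticAt ℂ g x) (hg0 : g x = 0)
      (hm : meromorphicOrderAt g x = m) : 0 < m := by
    have ht := hg.continuousAt.tendsto.mono_left (nhdsWithin_le_nhds (s := {x}ᶜ))
    rw [hg0, tendsto_zero_iff_meromorphicOrderAt_pos hg.meromorphicAt, hm] at ht
    exact_mod_cast ht
  have hn0 := hpos hf h0 hn.symm
  have hd := meromorphicOrderAt_deriv_eq_sub_one (n := n) (by exact_mod_cast hn0.ne') hn.symm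
  have hn1 := hpos hf.deriv h1 hd
  have hdd := meromorphicOrderAt_deriv_eq_sub_one (n := n - 1) (by exact_mod_cast hn1.ne') hd
  have h2 : meromorphicOrderAt (deriv (deriv f)) x = meromorphicOrderAt (c * f) x :=
    meromorphicOrderAt_congr (nhdsWithin_le_nhds h)
  rw [meromorphicOrderAt_mul hc.meromorphicAt hf.meromorphicAt, hdd, ← hn] at h2
  have h3 : ((n : ℤ) : WithTop ℤ) ≤ ((n - 1 - 1 : ℤ) : WithTop ℤ) := by
    rw [h2]
    exact le_add_of_nonneg_left hc.meromorphicOrderAt_nonneg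
  have h4 : n ≤ n - 1 - 1 := by exact_mod_cast h3
  omega

lemma order_comp_add (f : ℂ → ℂ) (x c : ℂ) :
    meromorphicOrderAt (fun z => f (z + c)) x = meromorphicOrderAt f (x + c) :=
  meromorphicOrderAt_comp_add_const_eq_meromorphicOrderAt

lemma analyticAt_comp_add {f : ℂ → ℂ} {x c : ℂ} (hf : AnalyticAt ℂ f (x + c)) :
    AnalyticAt ℂ (fun z => f (z + c)) x :=
  hf.fun_comp_of_eq (analyticAt_id.add analyticAt_const) rfl

lemma sub_mem_lattice_of_wp_eq {a b : ℂ} (ha : a ∉ Λ) (hb : b ∉ Λ) (h : wp a = wp b)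
    (h' : wpd a = wpd b) : b - a ∈ Λ := by
  set f : ℂ → ℂ := fun z => wp (z + a) - wp (z + b) with hfdef
  have hm (z : ℂ) : MeromorphicAt f z :=
    (meromorphicAt_comp_add_const_iff_meromorphicAt.2 (meromorphicAt_wp (z + a))).sub
      (meromorphicAt_comp_add_const_iff_meromorphicAt.2 (meromorphicAt_wp (z + b)))
  have ha0 (c : ℂ) (hc : c ∉ Λ) : ∀ᶠ z in 𝓝 (0 : ℂ), z + c ∉ Λ := by
    have : Tendsto (fun z : ℂ => z + c) (𝓝 0) (𝓝 c) := by
      have h1 : Continuous fun z : ℂ => z + c := by fun_prop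
      simpa using h1.tendsto 0
    exact this.eventually (isOpen_compl_lattice.mem_nhds hc)
  have hd1 : ∀ᶠ z in 𝓝 (0 : ℂ), deriv f z = wpd (z + a) - wpd (z + b) := by
    filter_upwards [ha0 a ha, ha0 b hb] with z h1 h2
    rw [hfdef, deriv_fun_sub (analyticAt_comp_add (analyticAt_wp h1)).differentiableAt
      (analyticAt_comp_add (analyticAt_wp h2)).differentiableAt, deriv_comp_add_const,
      deriv_comp_add_const, deriv_wp]
  have htop : meromorphicOrderAt f 0 = ⊤ := by
    refine order_eq_top_of_deriv_deriv_eq (c := fun z => 6 * (wp (z + a) + wp (z + b)))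
      ?_ ?_ ?_ ?_ ?_
    · exact (analyticAt_comp_add (by simpa using analyticAt_wp ha)).sub
        (analyticAt_comp_add (by simpa using analyticAt_wp hb))
    · exact analyticAt_const.mul ((analyticAt_comp_add (by simpa using analyticAt_wp ha)).add
        (analyticAt_comp_add (by simpa using analyticAt_wp hb)))
    · simp [hfdef, h]
    · simpa [h'] using hd1.self_of_nhds
    · filter_upwards [hd1.eventually_nhds, ha0 a ha, ha0 b hb] with z hz h1 h2
      rw [EventuallyEq.deriv_eq hz,
        deriv_fun_sub (analyticAt_comp_add (analyticAt_wpd h1)).differentiableAt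
          (analyticAt_comp_add (analyticAt_wpd h2)).differentiableAt, deriv_comp_add_const,
        deriv_comp_add_const, deriv_wpd h1, deriv_wpd h2]
      ring
  by_contra hab
  have htop' : meromorphicOrderAt f (-a) = ⊤ := by
    by_contra h1
    exact order_ne_top_of_order_ne_top hm h1 0 htop
  have hpole : meromorphicOrderAt (fun z => wp (z + a)) (-a) = -2 := by
    rw [order_comp_add, neg_add_cancel, order_wp zero_mem_lattice]
  have heq : meromorphicOrderAt (fun z => wp (z + a)) (-a) =
      meromorphicOrderAt (fun z => wp (z + b)) (-a) :=
    meromorphicOrderAt_congr ((meromorphicOrderAt_eq_top_iff.1 htop').mono fun z hz =>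
      sub_eq_zero.1 hz)
  have hnonneg : 0 ≤ meromorphicOrderAt (fun z => wp (z + b)) (-a) :=
    (analyticAt_comp_add (analyticAt_wp (by rwa [neg_add_eq_sub]))).meromorphicOrderAt_nonneg
  rw [← heq, hpole] at hnonneg
  exact absurd hnonneg (by decide)

lemma neg_zS_not_mem_lattice : -zS ∉ Λ := fun h => zS_not_mem_lattice (neg_mem_lattice_iff.1 h)

lemma wp_zS : wp zS = 0 := by
  have h := wp_omega_mul zS
  rw [omega_mul_zS, wp_add neg_one_sub_omega_mem_lattice, zpow_neg, zpow_natCast] at h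
  have h1 : (1 - (ω ^ 2)⁻¹) * wp zS = 0 := by linear_combination h
  refine (mul_eq_zero.1 h1).resolve_left ?_
  rw [sub_eq_zero, ← ne_eq, ne_comm, inv_ne_one]
  exact omega_sq_ne_one

/-- The classes of the stacking points. -/
def stacking : Set ℂ := {z | z - zS ∈ Λ ∨ z + zS ∈ Λ}

lemma not_mem_lattice_of_mem_stacking {z : ℂ} (hz : z ∈ stacking) : z ∉ Λ := by
  rintro h
  rcases hz with hz | hz
  · exact zS_not_mem_lattice (by simpa using sub_mem_lattice h hz)
  · exact zS_not_mem_lattice (by simpa using sub_mem_lattice hz h)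

lemma wp_eq_zero_of_mem_stacking {z : ℂ} (hz : z ∈ stacking) : wp z = 0 := by
  rcases hz with hz | hz
  · rw [← wp_zS, ← wp_add hz zS, add_sub_cancel]
  · rw [← wp_zS, ← wp_neg zS, ← wp_add hz (-zS), add_comm z, neg_add_cancel_left]

lemma periods_g₃_ne_zero : periods.g₃ ≠ 0 := fun h => by
  have h1 : wpd zS = 0 := by
    have := wpd_sq zS_not_mem_lattice
    rw [wp_zS, h] at this
    simpa using this
  have h2 := sub_mem_lattice_of_wp_eq neg_zS_not_mem_lattice zS_not_mem_lattice (wp_neg zS)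
    (by rw [wpd_neg, h1, neg_zero])
  rw [sub_neg_eq_add] at h2
  exact two_mul_zS_not_mem_lattice h2

lemma wpd_ne_zero_of_wp_eq_zero {z : ℂ} (hz : z ∉ Λ) (h : wp z = 0) : wpd z ≠ 0 := fun h1 => by
  have := wpd_sq hz
  rw [h, h1] at this
  exact periods_g₃_ne_zero (by linear_combination this)

lemma mem_stacking_of_wp_eq_zero {z : ℂ} (hz : z ∉ Λ) (h : wp z = 0) : z ∈ stacking := by
  have h1 : wpd z ^ 2 = wpd zS ^ 2 := by rw [wpd_sq hz, wpd_sq zS_not_mem_lattice, h, wp_zS]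
  rcases sq_eq_sq_iff_eq_or_eq_neg.1 h1 with h2 | h2
  · exact .inl (sub_mem_lattice_of_wp_eq zS_not_mem_lattice hz (by rw [h, wp_zS]) h2.symm)
  · refine .inr ?_
    have := sub_mem_lattice_of_wp_eq neg_zS_not_mem_lattice hz (by rw [h, wp_neg, wp_zS])
      (by rw [h2, wpd_neg])
    rwa [sub_neg_eq_add] at this

/-- A simple zero of an analytic function has order one. -/
lemma order_eq_one {f : ℂ → ℂ} {x : ℂ} (hf : AnalyticAt ℂ f x) (h0 : f x = 0)
    (h1 : deriv f x ≠ 0) : meromorphicOrderAt f x = ((1 : ℤ) : WithTop ℤ) := by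
  have h2 := hf.analyticOrderAt_sub_eq_one_of_deriv_ne_zero h1
  simp only [h0, sub_zero] at h2
  rw [hf.meromorphicOrderAt_eq, h2]
  rfl

lemma order_wp_of_mem_stacking {z : ℂ} (hz : z ∈ stacking) :
    meromorphicOrderAt wp z = ((1 : ℤ) : WithTop ℤ) := by
  have hz' := not_mem_lattice_of_mem_stacking hz
  have h0 := wp_eq_zero_of_mem_stacking hz
  refine order_eq_one (analyticAt_wp hz') h0 ?_
  rw [deriv_wp]
  exact wpd_ne_zero_of_wp_eq_zero hz' h0

lemma order_eq_zero_of_ne_zero {f : ℂ → ℂ} {x : ℂ} (hf : AnalyticAt ℂ f x) (h0 : f x ≠ 0) :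
    meromorphicOrderAt f x = 0 := by
  rw [hf.meromorphicOrderAt_eq, hf.analyticOrderAt_eq_zero.2 h0]
  rfl

lemma eq_or_of_wpd_eq {a b : ℂ} (ha : a ∉ Λ) (hb : b ∉ Λ) (h : wpd a = wpd b) :
    ∃ j : ℕ, b - ω ^ j * a ∈ Λ := by
  have h1 : wp b ^ 3 = wp a ^ 3 := by
    have h1 := wpd_sq ha
    rw [h, wpd_sq hb] at h1
    linear_combination h1 / 4
  have h2 : (wp b - wp a) * ((wp b - ω * wp a) * (wp b - ω ^ 2 * wp a)) = 0 := by
    linear_combination h1 + (-wp b ^ 2 * wp a - (ω - 1) * wp a ^ 3 + wp a ^ 2 * wp b * ω) * omega_sq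
  have h3 (z : ℂ) : wp (ω * z) = ω * wp z := by
    rw [wp_omega_mul, zpow_neg, zpow_natCast]
    have : (ω ^ 2)⁻¹ = ω := inv_eq_of_mul_eq_one_right (by rw [← pow_succ, omega_pow_three])
    rw [this]
  have h4 (z : ℂ) : wpd (ω * z) = wpd z := by
    rw [wpd_omega_mul]
    simp
  have h5 (z : ℂ) (j : ℕ) : wp (ω ^ j * z) = ω ^ j * wp z ∧ wpd (ω ^ j * z) = wpd z := by
    induction j with
    | zero => simp
    | succ j ih => rw [pow_succ', mul_assoc, h3, h4, ih.1, ih.2, mul_assoc]; simp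
  have h6 (j : ℕ) : ω ^ j * a ∉ Λ := by
    induction j with
    | zero => simpa using ha
    | succ j ih => rwa [pow_succ', mul_assoc, omega_mul_mem_lattice_iff]
  have h7 (j : ℕ) (hj : wp b = ω ^ j * wp a) : b - ω ^ j * a ∈ Λ :=
    sub_mem_lattice_of_wp_eq (h6 j) hb (by rw [(h5 a j).1, hj]) (by rw [(h5 a j).2, h])
  rcases mul_eq_zero.1 h2 with h2 | h2
  · exact ⟨0, h7 0 (by rw [pow_zero, one_mul, sub_eq_zero.1 h2])⟩
  rcases mul_eq_zero.1 h2 with h2 | h2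
  · exact ⟨1, h7 1 (by rw [pow_one, sub_eq_zero.1 h2])⟩
  · exact ⟨2, h7 2 (sub_eq_zero.1 h2)⟩

lemma meromorphicAt_wpd_sub (c z : ℂ) : MeromorphicAt (fun z => wpd z - c) z :=
  (meromorphicAt_wpd z).sub (MeromorphicAt.const c z)

lemma order_wpd_sub (c : ℂ) {z : ℂ} (hz : z ∈ Λ) :
    meromorphicOrderAt (fun z => wpd z - c) z = ((-3 : ℤ) : WithTop ℤ) := by
  have h : meromorphicOrderAt wpd z < meromorphicOrderAt (fun _ : ℂ => -c) z := by
    rw [order_wpd hz]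
    refine lt_of_lt_of_le ?_ (analyticAt_const (v := -c)).meromorphicOrderAt_nonneg
    decide
  have := meromorphicOrderAt_add_eq_left_of_lt (MeromorphicAt.const (-c) z) h
  rw [← order_wpd hz, ← this]
  rfl

lemma order_wpd_sub_of_eq {c z : ℂ} (hz : z ∉ Λ) (h : wpd z = c) (h0 : wp z ≠ 0) :
    meromorphicOrderAt (fun z => wpd z - c) z = ((1 : ℤ) : WithTop ℤ) := by
  refine order_eq_one ((analyticAt_wpd hz).sub analyticAt_const) (by simp [h]) ?_
  rw [deriv_sub_const, deriv_wpd hz]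
  simp [h0]

lemma order_wpd_sub_of_ne {c z : ℂ} (hz : z ∉ Λ) (h : wpd z ≠ c) :
    meromorphicOrderAt (fun z => wpd z - c) z = 0 :=
  order_eq_zero_of_ne_zero ((analyticAt_wpd hz).sub analyticAt_const) (sub_ne_zero.2 h)

end EllipticZeros

section Fourier

/-- The parametrization of the plane in which the lattice is `ℤ²`. -/
def chart : (Fin 2 → ℝ) →L[ℝ] ℂ :=
  (ContinuousLinearMap.proj (R := ℝ) (φ := fun _ : Fin 2 => ℝ) 0).smulRight ω +
    (ContinuousLinearMap.proj (R := ℝ) (φ := fun _ : Fin 2 => ℝ) 1).smulRight (1 : ℂ)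

lemma chart_apply (x : Fin 2 → ℝ) : chart x = x 0 * ω + x 1 := by simp [chart]

/-- Integral over a fundamental cell of the lattice. -/
def cellIntegral (h : ℂ → ℂ) : ℂ := ∫ x in Set.Icc (0 : Fin 2 → ℝ) 1, h (chart x)

lemma integrableOn_cell {E : Type*} [NormedAddCommGroup E] {h : ℂ → E} (hh : Continuous h) :
    IntegrableOn (fun x => h (chart x)) (Set.Icc (0 : Fin 2 → ℝ) 1) :=
  (hh.comp chart.continuous).continuousOn.integrableOn_compact isCompact_Icc

lemma cellIntegral_add {f g : ℂ → ℂ} (hf : Continuous f) (hg : Continuous g) :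
    cellIntegral (fun z => f z + g z) = cellIntegral f + cellIntegral g :=
  integral_add (integrableOn_cell hf) (integrableOn_cell hg)

lemma cellIntegral_const_mul (c : ℂ) (f : ℂ → ℂ) :
    cellIntegral (fun z => c * f z) = c * cellIntegral f :=
  integral_const_mul c _

lemma mem_lattice_int (m n : ℤ) : (m : ℂ) * ω + n ∈ Λ := ⟨m, n, rfl⟩

lemma omega_mem_lattice : ω ∈ Λ := ⟨1, 0, by simp⟩

lemma one_mem_lattice : (1 : ℂ) ∈ Λ := ⟨0, 1, by simp⟩

lemma sqrt_three_ne_zero : ((Real.sqrt 3 : ℝ) : ℂ) ≠ 0 := by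
  simp

lemma cauchyRiemann_eq_lattice (h : ℂ → ℂ) (z : ℂ) :
    cauchyRiemann h z = 2 * I / Real.sqrt 3 * fderiv ℝ h z ω +
      (1 + I / Real.sqrt 3) * fderiv ℝ h z 1 := by
  have h1 : (I : ℂ) = (2 / Real.sqrt 3 : ℝ) • ω + (1 / Real.sqrt 3 : ℝ) • (1 : ℂ) := by
    have := sqrt_three_ne_zero
    rw [omega_eq]
    simp
    field_simp
    ring_nf
  have h2 : fderiv ℝ h z I = (2 / Real.sqrt 3 : ℂ) * fderiv ℝ h z ω +
      (1 / Real.sqrt 3 : ℂ) * fderiv ℝ h z 1 := by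
    conv_lhs => rw [h1, map_add, map_smul, map_smul]
    simp
  rw [cauchyRiemann, h2]
  simp only [smul_eq_mul]
  ring

/-- Integration by parts over a fundamental cell. -/
lemma cellIntegral_cauchyRiemann {h : ℂ → ℂ} (hh : ContDiff ℝ (⊤ : ℕ∞) h)
    (hper : ∀ γ ∈ Λ, ∀ z, h (z + γ) = h z) : cellIntegral (cauchyRiemann h) = 0 := by
  set A : Fin 2 → ℂ := ![2 * I / Real.sqrt 3, 1 + I / Real.sqrt 3] with hA
  have hd (i : Fin 2) (x : Fin 2 → ℝ) : HasFDerivAt (fun x => A i * h (chart x))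
      (A i • ((fderiv ℝ h (chart x)).comp chart)) x := by
    have h1 := (hh.differentiable (by simp) (chart x)).hasFDerivAt.comp x chart.hasFDerivAt
    exact h1.const_mul (A i)
  have hs (x : Fin 2 → ℝ) : cauchyRiemann h (chart x) = ∑ i : Fin 2,
      (A i • ((fderiv ℝ h (chart x)).comp chart)) (Pi.single i 1) := by
    rw [Fin.sum_univ_two, cauchyRiemann_eq_lattice]
    simp [hA, chart_apply]
  have key := integral_divergence_of_hasFDerivAt_off_countable' (0 : Fin 2 → ℝ) 1 zero_le_one
    (fun i x => A i * h (chart x)) (fun i x => A i • ((fderiv ℝ h (chart x)).comp chart)) ∅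
    Set.countable_empty
    (fun i => (continuous_const.mul (hh.continuous.comp chart.continuous)).continuousOn)
    (fun x _ i => hd i x) (by
      simp_rw [← hs]
      exact integrableOn_cell (continuous_cauchyRiemann hh))
  simp_rw [← hs] at key
  rw [cellIntegral, key]
  refine Finset.sum_eq_zero fun i _ => sub_eq_zero.2 ?_
  congr 1
  funext x
  congr 1
  fin_cases i
  · have h1 := hper ω omega_mem_lattice (x 0)
    simp [chart_apply]
    rw [← h1, add_comm]
  · have h1 := hper 1 one_mem_lattice (x 0 * ω)
    rw [chart_apply, chart_apply]
    have h2 (t : ℝ) : (Fin.insertNth (α := fun _ => ℝ) (1 : Fin 2) t x) 0 = x 0 := rfl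
    simp [h2, h1]

/-- The circle carries its normalized measure, as in Mathlib's Fourier theory on tori. -/
local instance : MeasureSpace UnitAddCircle := ⟨AddCircle.haarAddCircle⟩

/-- The normalized measure is a probability measure. -/
local instance : IsProbabilityMeasure (volume : Measure UnitAddCircle) :=
  inferInstanceAs (IsProbabilityMeasure AddCircle.haarAddCircle)

/-- A continuous doubly periodic function descends to the torus. -/
lemma exists_torus {g : ℂ → ℂ} (hg : Continuous g) (hper : ∀ γ ∈ Λ, ∀ z, g (z + γ) = g z) :
    ∃ G : C(UnitAddTorus (Fin 2), ℂ), ∀ x : Fin 2 → ℝ,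
      G (fun i => (x i : UnitAddCircle)) = g (chart x) := by
  have hq : IsOpenQuotientMap (Pi.map fun (_ : Fin 2) (t : ℝ) => (t : UnitAddCircle)) :=
    IsOpenQuotientMap.piMap fun _ => QuotientAddGroup.isOpenQuotientMap_mk
  have hinv (x y : Fin 2 → ℝ) (hxy : Pi.map (fun (_ : Fin 2) (t : ℝ) => (t : UnitAddCircle)) x =
      Pi.map (fun (_ : Fin 2) (t : ℝ) => (t : UnitAddCircle)) y) :
      g (chart x) = g (chart y) := by
    have h1 (i : Fin 2) : ∃ n : ℤ, y i + n = x i := by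
      have h2 : ((x i - y i : ℝ) : UnitAddCircle) = 0 := by
        rw [AddCircle.coe_sub, sub_eq_zero]
        exact congr_fun hxy i
      obtain ⟨n, hn⟩ := (AddCircle.coe_eq_zero_iff 1).1 h2
      exact ⟨n, by simp at hn; linarith⟩
    obtain ⟨m, hm⟩ := h1 0
    obtain ⟨n, hn⟩ := h1 1
    rw [← hper _ (mem_lattice_int m n) (chart y), chart_apply, chart_apply, ← hm, ← hn]
    congr 1
    push_cast
    ring
  let G : UnitAddTorus (Fin 2) → ℂ := fun t => g (chart (Function.surjInv hq.surjective t))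
  have hG (x : Fin 2 → ℝ) : G (Pi.map (fun (_ : Fin 2) (t : ℝ) => (t : UnitAddCircle)) x) =
      g (chart x) := hinv _ _ (Function.surjInv_eq hq.surjective _)
  refine ⟨⟨G, hq.isQuotientMap.continuous_iff.2 ?_⟩, hG⟩
  have : G ∘ Pi.map (fun (_ : Fin 2) (t : ℝ) => (t : UnitAddCircle)) = g ∘ chart := funext hG
  rw [this]
  exact hg.comp chart.continuous

/-- The coordinates dual to the basis `ω, 1` of the plane. -/
def dualCoord (n : Fin 2 → ℤ) : ℂ →L[ℝ] ℝ :=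
  (2 * n 0 / Real.sqrt 3 : ℝ) • imCLM + (n 1 : ℝ) • (reCLM + (1 / Real.sqrt 3 : ℝ) • imCLM)

lemma dualCoord_chart (n : Fin 2 → ℤ) (x : Fin 2 → ℝ) :
    dualCoord n (chart x) = n 0 * x 0 + n 1 * x 1 := by
  have h : Real.sqrt 3 ≠ 0 := by simp
  simp [dualCoord, chart_apply, omega_re, omega_im]
  field_simp
  ring

/-- The characters of the plane that are trivial on the lattice. -/
def character (n : Fin 2 → ℤ) (z : ℂ) : ℂ := exp (2 * Real.pi * I * dualCoord n z)

lemma contDiff_character (n : Fin 2 → ℤ) : ContDiff ℝ (⊤ : ℕ∞) (character n) := by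
  have h1 : ContDiff ℝ (⊤ : ℕ∞) fun z => (dualCoord n z : ℂ) :=
    ofRealCLM.contDiff.comp (dualCoord n).contDiff
  exact (contDiff_const.mul h1).cexp

lemma character_add_of_mem (n : Fin 2 → ℤ) {γ : ℂ} (hγ : γ ∈ Λ) (z : ℂ) :
    character n (z + γ) = character n z := by
  obtain ⟨a, b, rfl⟩ := hγ
  have h1 : dualCoord n (a * ω + b) = (n 0 * a + n 1 * b : ℤ) := by
    have := dualCoord_chart n ![a, b]
    rw [chart_apply] at this
    simpa using this
  rw [character, map_add, h1, character, exp_eq_exp_iff_exists_int]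
  refine ⟨n 0 * a + n 1 * b, ?_⟩
  push_cast
  ring

lemma character_chart (n : Fin 2 → ℤ) (x : Fin 2 → ℝ) :
    character n (chart x) = UnitAddTorus.mFourier n (fun i => (x i : UnitAddCircle)) := by
  rw [character, dualCoord_chart, UnitAddTorus.mFourier]
  simp only [ContinuousMap.coe_mk, Fin.prod_univ_two, fourier_coe_apply, ← exp_add]
  congr 1
  push_cast
  ring

lemma setIntegral_Ioc_eq_Icc {E : Type} [NormedAddCommGroup E] [NormedSpace ℝ E]
    (f : (Fin 2 → ℝ) → E) :
    ∫ x in {x : Fin 2 → ℝ | ∀ i, x i ∈ Set.Ioc ((0 : Fin 2 → ℝ) i) ((0 : Fin 2 → ℝ) i + 1)}, f x =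
      ∫ x in Set.Icc (0 : Fin 2 → ℝ) 1, f x := by
  have h1 := Measure.univ_pi_Ioc_ae_eq_Icc (μ := fun _ : Fin 2 => (volume : Measure ℝ))
    (f := (0 : Fin 2 → ℝ)) (g := 1)
  rw [volume_pi, ← setIntegral_congr_set h1]
  congr 3
  ext x
  simp

lemma mFourierCoeff_eq_cellIntegral {g : ℂ → ℂ} {G : C(UnitAddTorus (Fin 2), ℂ)}
    (hG : ∀ x : Fin 2 → ℝ, G (fun i => (x i : UnitAddCircle)) = g (chart x)) (n : Fin 2 → ℤ) :
    UnitAddTorus.mFourierCoeff G n = cellIntegral fun z => character (-n) z * g z := by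
  rw [UnitAddTorus.mFourierCoeff_eq_integral _ _ 0, setIntegral_Ioc_eq_Icc]
  simp_rw [hG, ← character_chart]
  rfl

lemma hasSum_sq_cellIntegral {g : ℂ → ℂ} (hg : Continuous g)
    (hper : ∀ γ ∈ Λ, ∀ z, g (z + γ) = g z) :
    HasSum (fun n : Fin 2 → ℤ => ‖cellIntegral fun z => character (-n) z * g z‖ ^ 2)
      (∫ x in Set.Icc (0 : Fin 2 → ℝ) 1, ‖g (chart x)‖ ^ 2) := by
  obtain ⟨G, hG⟩ := exists_torus hg hper
  have h := UnitAddTorus.hasSum_sq_mFourierCoeff (ContinuousMap.toLp 2 volume ℂ G)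
  convert h using 1
  · funext n
    rw [UnitAddTorus.mFourierCoeff_toLp, mFourierCoeff_eq_cellIntegral hG]
  · have h1 : (fun x => ‖ContinuousMap.toLp 2 volume ℂ G x‖ ^ 2) =ᵐ[volume]
        fun x => ‖G x‖ ^ 2 := by
      filter_upwards [ContinuousMap.coeFn_toLp (p := 2) (𝕜 := ℂ) volume G] with x hx
      rw [hx]
    rw [integral_congr_ae h1, UnitAddTorus.integral_preimage _ 0, setIntegral_Ioc_eq_Icc]
    simp_rw [hG]

lemma exists_chart_eq (z : ℂ) : ∃ x : Fin 2 → ℝ, chart x = z := by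
  have h : Real.sqrt 3 ≠ 0 := by simp
  refine ⟨![2 * z.im / Real.sqrt 3, z.re + z.im / Real.sqrt 3], ?_⟩
  apply Complex.ext
  · simp [chart_apply, omega_re]
    ring
  · simp [chart_apply, omega_im]
    field_simp

lemma eq_zero_of_forall_cellIntegral_eq_zero {g : ℂ → ℂ} (hg : Continuous g)
    (hper : ∀ γ ∈ Λ, ∀ z, g (z + γ) = g z)
    (h : ∀ n : Fin 2 → ℤ, cellIntegral (fun z => character (-n) z * g z) = 0) : g = 0 := by
  obtain ⟨G, hG⟩ := exists_torus hg hper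
  have h0 (n : Fin 2 → ℤ) : UnitAddTorus.mFourierCoeff G n = 0 := by
    rw [mFourierCoeff_eq_cellIntegral hG, h]
  have hs : Summable (UnitAddTorus.mFourierCoeff G) := by
    rw [show UnitAddTorus.mFourierCoeff G = 0 from funext h0]
    exact summable_zero
  funext z
  obtain ⟨x, rfl⟩ := exists_chart_eq z
  have h1 := UnitAddTorus.hasSum_mFourier_series_apply_of_summable hs
    (fun i => (x i : UnitAddCircle))
  simp only [h0, zero_smul, hG] at h1
  exact h1.unique hasSum_zero

lemma exists_norm_le {g : ℂ → ℂ} (hg : Continuous g)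
    (hper : ∀ γ ∈ Λ, ∀ z, ‖g (z + γ)‖ = ‖g z‖) : ∃ M : ℝ, ∀ z, ‖g z‖ ≤ M := by
  obtain ⟨G, hG⟩ := exists_torus (g := fun z => (‖g z‖ : ℂ)) (by fun_prop)
    fun γ hγ z => by rw [hper γ hγ]
  refine ⟨‖G‖, fun z => ?_⟩
  obtain ⟨x, rfl⟩ := exists_chart_eq z
  have := G.norm_coe_le_norm (fun i => (x i : UnitAddCircle))
  rwa [hG, norm_real, norm_norm] at this

end Fourier

section FourierKernel

/-- The Fourier coefficients of a doubly periodic function. -/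
def latticeCoeff (n : Fin 2 → ℤ) (g : ℂ → ℂ) : ℂ := cellIntegral fun z => character (-n) z * g z

lemma latticeCoeff_add (n : Fin 2 → ℤ) {f g : ℂ → ℂ} (hf : Continuous f) (hg : Continuous g) :
    latticeCoeff n (fun z => f z + g z) = latticeCoeff n f + latticeCoeff n g := by
  have h := (contDiff_character (-n)).continuous
  simp_rw [latticeCoeff, mul_add]
  exact cellIntegral_add (h.mul hf) (h.mul hg)

lemma latticeCoeff_const_mul (n : Fin 2 → ℤ) (c : ℂ) (f : ℂ → ℂ) :
    latticeCoeff n (fun z => c * f z) = c * latticeCoeff n f := by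
  rw [latticeCoeff, latticeCoeff, ← cellIntegral_const_mul]
  simp_rw [mul_left_comm]

lemma cauchyRiemann_mul {f g : ℂ → ℂ} {z : ℂ} (hf : DifferentiableAt ℝ f z)
    (hg : DifferentiableAt ℝ g z) :
    cauchyRiemann (fun z => f z * g z) z = f z * cauchyRiemann g z + cauchyRiemann f z * g z := by
  rw [cauchyRiemann, (hf.hasFDerivAt.fun_mul hg.hasFDerivAt).fderiv]
  simp [cauchyRiemann]
  ring

lemma cauchyRiemann_exp (c : ℂ) (L : ℂ →L[ℝ] ℝ) (z : ℂ) :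
    cauchyRiemann (fun z => exp (c * (L z : ℂ))) z =
      c * (L 1 + I * L I) * exp (c * (L z : ℂ)) := by
  have h1 : HasFDerivAt (fun z => (L z : ℂ)) (ofRealCLM.comp L) z :=
    (ofRealCLM.comp L).hasFDerivAt
  rw [cauchyRiemann, (h1.const_mul c).cexp.fderiv]
  simp
  ring

lemma latticeCoeff_cauchyRiemann (n : Fin 2 → ℤ) {g : ℂ → ℂ} (hg : ContDiff ℝ (⊤ : ℕ∞) g)
    (hper : ∀ γ ∈ Λ, ∀ z, g (z + γ) = g z) :
    latticeCoeff n (cauchyRiemann g) =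
      -(2 * Real.pi * I * (dualCoord (-n) 1 + I * dualCoord (-n) I)) * latticeCoeff n g := by
  have hc := contDiff_character (-n)
  have h0 := cellIntegral_cauchyRiemann (hc.mul hg) fun γ hγ z => by
    rw [character_add_of_mem _ hγ, hper γ hγ]
  have h1 (z : ℂ) : cauchyRiemann (fun z => character (-n) z * g z) z =
      character (-n) z * cauchyRiemann g z +
        (2 * Real.pi * I * (dualCoord (-n) 1 + I * dualCoord (-n) I)) *
          (character (-n) z * g z) := by
    rw [cauchyRiemann_mul (hc.differentiable (by simp) z) (hg.differentiable (by simp) z)]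
    unfold character
    rw [cauchyRiemann_exp]
    ring
  have h2 := cellIntegral_const_mul
    (2 * Real.pi * I * (dualCoord (-n) 1 + I * dualCoord (-n) I)) fun z => character (-n) z * g z
  rw [funext h1] at h0
  have h3 := (cellIntegral_add (hc.continuous.mul (continuous_cauchyRiemann hg))
    (continuous_const.mul (hc.continuous.mul hg.continuous))).symm.trans h0
  have h4 := (congr_arg₂ (· + ·) rfl h2).symm.trans h3
  rw [latticeCoeff, latticeCoeff]
  linear_combination h4

lemma sq_add_sq_mul_latticeCoeff_le (n : Fin 2 → ℤ) {g : ℂ → ℂ} (hg : ContDiff ℝ (⊤ : ℕ∞) g)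
    (hper : ∀ γ ∈ Λ, ∀ z, g (z + γ) = g z) :
    ((n 0 : ℝ) ^ 2 + (n 1 : ℝ) ^ 2) * ‖latticeCoeff n g‖ ^ 2 ≤
      ‖latticeCoeff n (cauchyRiemann g)‖ ^ 2 := by
  have h3 : Real.sqrt 3 ^ 2 = 3 := Real.sq_sqrt (by norm_num)
  have hs : Real.sqrt 3 ≠ 0 := by simp
  have h1 : ‖(2 * Real.pi * I * (dualCoord (-n) 1 + I * dualCoord (-n) I) : ℂ)‖ ^ 2 =
      16 * Real.pi ^ 2 / 3 * ((n 0 : ℝ) ^ 2 + n 0 * n 1 + (n 1 : ℝ) ^ 2) := by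
    rw [norm_mul, mul_pow, norm_mul, norm_mul, norm_I, norm_real, ← normSq_eq_norm_sq,
      normSq_apply]
    simp [dualCoord, abs_of_pos Real.pi_pos]
    field_simp
    ring_nf
    simp [h3, show Real.sqrt 3 ^ 4 = 9 by rw [show 4 = 2 * 2 from rfl, pow_mul, h3]; norm_num]
    ring
  rw [latticeCoeff_cauchyRiemann n hg hper, norm_mul, mul_pow, norm_neg, h1]
  gcongr
  have hpi : 9 ≤ Real.pi ^ 2 := by nlinarith [Real.pi_gt_three]
  have h2 : 0 ≤ (n 0 : ℝ) ^ 2 + n 0 * n 1 + (n 1 : ℝ) ^ 2 := by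
    nlinarith [sq_nonneg ((n 0 : ℝ) + n 1), sq_nonneg (n 0 : ℝ), sq_nonneg (n 1 : ℝ)]
  nlinarith [mul_nonneg (sub_nonneg.2 hpi) h2, sq_nonneg ((n 0 : ℝ) + n 1)]

/-- A system of Cauchy-Riemann inequalities controls periodic functions by finitely many Fourier
coefficients. -/
lemma eq_zero_of_latticeCoeff_eq_zero {v : Fin 2 → ℂ → ℂ} {C : ℝ} (hC : 0 < C)
    (hv : ∀ i, ContDiff ℝ (⊤ : ℕ∞) (v i)) (hper : ∀ i, ∀ γ ∈ Λ, ∀ z, v i (z + γ) = v i z)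
    (hcr : ∀ i z, ‖cauchyRiemann (v i) z‖ ^ 2 ≤ C * (‖v 0 z‖ ^ 2 + ‖v 1 z‖ ^ 2))
    (h0 : ∀ i n, (n 0 : ℝ) ^ 2 + (n 1 : ℝ) ^ 2 ≤ 4 * C → latticeCoeff n (v i) = 0) (i : Fin 2) :
    v i = 0 := by
  have hcont (i : Fin 2) := continuous_cauchyRiemann (hv i)
  have hper' (i : Fin 2) (γ : ℂ) (hγ : γ ∈ Λ) (z : ℂ) :
      cauchyRiemann (v i) (z + γ) = cauchyRiemann (v i) z := by
    rw [← cauchyRiemann_comp_add_right, funext (hper i γ hγ)]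
  set S : Fin 2 → ℝ := fun i => ∫ x in Set.Icc (0 : Fin 2 → ℝ) 1, ‖v i (chart x)‖ ^ 2 with hS
  have hsum (i : Fin 2) : HasSum (fun n => ‖latticeCoeff n (v i)‖ ^ 2) (S i) :=
    hasSum_sq_cellIntegral (hv i).continuous (hper i)
  have hle (i : Fin 2) (n : Fin 2 → ℤ) :
      4 * C * ‖latticeCoeff n (v i)‖ ^ 2 ≤ ‖latticeCoeff n (cauchyRiemann (v i))‖ ^ 2 := by
    rcases le_total ((n 0 : ℝ) ^ 2 + (n 1 : ℝ) ^ 2) (4 * C) with h | h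
    · simp [h0 i n h]
    · refine le_trans ?_ (sq_add_sq_mul_latticeCoeff_le n (hv i) (hper i))
      gcongr
  have integrable {f : ℂ → ℂ} (hf : Continuous f) :
      IntegrableOn (fun x => ‖f (chart x)‖ ^ 2) (Set.Icc (0 : Fin 2 → ℝ) 1) :=
    integrableOn_cell (h := fun z => ‖f z‖ ^ 2) (by fun_prop)
  have hle' (i : Fin 2) : 4 * C * S i ≤ C * (S 0 + S 1) := by
    refine (hasSum_le (hle i) ((hsum i).mul_left _)
      (hasSum_sq_cellIntegral (hcont i) (hper' i))).trans ?_
    rw [hS, ← integral_add (integrable (hv 0).continuous) (integrable (hv 1).continuous),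
      ← integral_const_mul]
    exact integral_mono (integrable (hcont i))
      (((integrable (hv 0).continuous).add (integrable (hv 1).continuous)).const_mul C)
      fun x => hcr i (chart x)
  have hnn (i : Fin 2) : 0 ≤ S i := (hsum i).nonneg fun n => sq_nonneg _
  have hz : S i = 0 := by
    have h1 := hle' 0
    have h2 := hle' 1
    have h3 : S 0 + S 1 ≤ 0 := by nlinarith
    have := hnn 0
    have := hnn 1
    fin_cases i
    · change S 0 = 0
      linarith
    · change S 1 = 0
      linarith
  have hc (n : Fin 2 → ℤ) : latticeCoeff n (v i) = 0 := by
    have h1 := (hasSum_zero_iff_of_nonneg fun n => sq_nonneg ‖latticeCoeff n (v i)‖).1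
      (hz ▸ hsum i)
    simpa using congr_fun h1 n
  exact eq_zero_of_forall_cellIntegral_eq_zero (hv i).continuous (hper i) hc

lemma finite_frequencies (R : ℝ) : {n : Fin 2 → ℤ | (n 0 : ℝ) ^ 2 + (n 1 : ℝ) ^ 2 ≤ R}.Finite := by
  obtain ⟨M, hM⟩ := exists_nat_gt R
  refine (Set.finite_Icc (fun _ => -(M : ℤ)) (fun _ => (M : ℤ))).subset fun n hn => ?_
  have h (i : Fin 2) : -(M : ℤ) ≤ n i ∧ n i ≤ M := by
    have h1 : (n i : ℝ) ^ 2 < M := by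
      refine lt_of_le_of_lt ?_ (lt_of_le_of_lt hn hM)
      fin_cases i <;> simp [sq_nonneg]
    have h2 : n i ^ 2 < M := by exact_mod_cast h1
    constructor <;> nlinarith
  exact ⟨fun i => (h i).1, fun i => (h i).2⟩

/-- The real linear form `z ↦ ⟨z, K⟩`. -/
def pairK : ℂ →L[ℝ] ℝ := (4 * Real.pi / 3) • reCLM

lemma pairK_apply (z : ℂ) : pairK z = pair z K := by
  have : (K : ℂ) = ((4 * Real.pi / 3 : ℝ) : ℂ) := by simp [K]
  rw [pair, this, conj_ofReal, re_mul_ofReal]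
  simp [pairK, mul_comm]

/-- The components of `u`, made doubly periodic. -/
def untwist (u : ℂ → ℂ × ℂ) : Fin 2 → ℂ → ℂ :=
  ![fun z => exp (I * (pairK z : ℂ)) * (u z).1, fun z => exp (-I * (pairK z : ℂ)) * (u z).2]

lemma contDiff_exp_pairK (c : ℂ) : ContDiff ℝ (⊤ : ℕ∞) fun z => exp (c * (pairK z : ℂ)) :=
  (contDiff_const.mul (ofRealCLM.contDiff.comp pairK.contDiff)).cexp

lemma contDiff_untwist {u : ℂ → ℂ × ℂ} (hu : ContDiff ℝ (⊤ : ℕ∞) u) (i : Fin 2) :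
    ContDiff ℝ (⊤ : ℕ∞) (untwist u i) := by
  fin_cases i
  · exact (contDiff_exp_pairK I).mul hu.fst
  · exact (contDiff_exp_pairK (-I)).mul hu.snd

/-- The kernel of the chiral model as a subspace. -/
def kernel (U : ℂ → ℂ) (α : ℂ) : Submodule ℂ (ℂ → ℂ × ℂ) where
  carrier := {u | ContDiff ℝ (⊤ : ℕ∞) u ∧ (∀ z, cauchyRiemann u z = coupling U α z (u z)) ∧
    ∀ γ ∈ Λ, ∀ z, u (z + γ) = floquet γ (u z)}
  zero_mem' := ⟨contDiff_const, fun z => by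
    rw [Pi.zero_apply, map_zero]
    simp [cauchyRiemann], fun γ _ z => by rw [Pi.zero_apply, Pi.zero_apply, map_zero]⟩
  add_mem' := by
    rintro u v ⟨h1, h2, h3⟩ ⟨k1, k2, k3⟩
    refine ⟨h1.add k1, fun z => ?_, fun γ hγ z => ?_⟩
    · rw [Pi.add_apply, map_add, ← h2, ← k2, cauchyRiemann, fderiv_add
        (h1.differentiable (by simp) z) (k1.differentiable (by simp) z)]
      simp only [cauchyRiemann, add_apply, smul_add]
      abel
    · rw [Pi.add_apply, Pi.add_apply, map_add, h3 γ hγ, k3 γ hγ]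
  smul_mem' := by
    rintro c u ⟨h1, h2, h3⟩
    refine ⟨contDiff_const.smul h1, fun z => ?_, fun γ hγ z => ?_⟩
    · rw [Pi.smul_apply, map_smul, ← h2]
      exact cauchyRiemann_smul (differentiableAt_const c) (h1.differentiable (by simp) z)
    · rw [Pi.smul_apply, Pi.smul_apply, map_smul, h3 γ hγ]

lemma kerPSet_subset_kernel (U : ℂ → ℂ) (α : ℂ) (p : ℕ) :
    kerPSet U (fun z => U (-z)) α p ⊆ kernel U α := fun u hu => by
  obtain ⟨h1, h2, h3, -⟩ := mem_kerPSet_iff.1 hu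
  exact ⟨h1, h2, h3⟩

lemma untwist_add_of_mem {U : ℂ → ℂ} {α : ℂ} {u : ℂ → ℂ × ℂ} (hu : u ∈ kernel U α) (i : Fin 2)
    {γ : ℂ} (hγ : γ ∈ Λ) (z : ℂ) : untwist u i (z + γ) = untwist u i z := by
  have h := hu.2.2 γ hγ z
  fin_cases i
  · simp only [untwist, Fin.zero_eta, Matrix.cons_val_zero, h, floquet_apply, map_add,
      ← pairK_apply]
    rw [← mul_assoc, ← exp_add]
    congr 2
    push_cast
    ring
  · simp only [untwist, Fin.mk_one, Matrix.cons_val_one, Matrix.cons_val_fin_one, h,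
      floquet_apply, map_add, ← pairK_apply]
    rw [← mul_assoc, ← exp_add]
    congr 2
    push_cast
    ring

lemma norm_exp_pairK (z : ℂ) :
    ‖exp (I * (pairK z : ℂ))‖ = 1 ∧ ‖exp (-I * (pairK z : ℂ))‖ = 1 := by
  constructor
  · rw [mul_comm, norm_exp_ofReal_mul_I]
  · rw [neg_mul, ← mul_neg, mul_comm, ← ofReal_neg, norm_exp_ofReal_mul_I]

lemma norm_untwist (u : ℂ → ℂ × ℂ) (z : ℂ) :
    ‖untwist u 0 z‖ = ‖(u z).1‖ ∧ ‖untwist u 1 z‖ = ‖(u z).2‖ := by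
  obtain ⟨h1, h2⟩ := norm_exp_pairK z
  constructor
  · simp only [untwist, Matrix.cons_val_zero, norm_mul, h1, one_mul]
  · simp only [untwist, Matrix.cons_val_one, Matrix.cons_val_fin_one, norm_mul, h2, one_mul]

lemma norm_cauchyRiemann_untwist_le {U : ℂ → ℂ} {α : ℂ} {u : ℂ → ℂ × ℂ} (hu : u ∈ kernel U α)
    {M : ℝ} (hM : ∀ z, ‖α‖ * ‖U z‖ ≤ M) (hM' : 4 * Real.pi / 3 ≤ M) (i : Fin 2) (z : ℂ) :
    ‖cauchyRiemann (untwist u i) z‖ ^ 2 ≤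
      2 * M ^ 2 * (‖untwist u 0 z‖ ^ 2 + ‖untwist u 1 z‖ ^ 2) := by
  obtain ⟨h1, h2, -⟩ := hu
  have hd := h1.differentiable (by simp) z
  have hcr := h2 z
  have hfst : cauchyRiemann (fun z => (u z).1) z = (cauchyRiemann u z).1 := by
    simp [cauchyRiemann, hd.hasFDerivAt.fst.fderiv]
  have hsnd : cauchyRiemann (fun z => (u z).2) z = (cauchyRiemann u z).2 := by
    simp [cauchyRiemann, hd.hasFDerivAt.snd.fderiv]
  rw [hcr, coupling_apply] at hfst hsnd
  obtain ⟨n1, n2⟩ := norm_untwist u z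
  obtain ⟨e1, e2⟩ := norm_exp_pairK z
  have hp (c : ℂ) (hc : ‖c‖ = 1) : ‖c * (pairK 1 + I * pairK I)‖ ≤ M := by
    simpa [pairK, hc, abs_of_pos Real.pi_pos] using hM'
  have hpi : 0 ≤ M := le_trans (by positivity) hM'
  have key (i : Fin 2) : ‖cauchyRiemann (untwist u i) z‖ ≤ M * (‖(u z).1‖ + ‖(u z).2‖) := by
    fin_cases i
    · simp only [untwist, Fin.zero_eta, Matrix.cons_val_zero]
      rw [cauchyRiemann_mul ((contDiff_exp_pairK I).differentiable (by simp) z) hd.fst, hfst,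
        cauchyRiemann_exp]
      refine (norm_add_le _ _).trans ?_
      simp only [norm_mul _ (exp _), norm_mul (exp _), norm_mul _ (u z).1, norm_mul _ (u z).2, e1]
      have := hp I norm_I
      have h3 : ‖-I * α * U z‖ ≤ M := by simpa using hM z
      nlinarith [norm_nonneg (u z).1, norm_nonneg (u z).2]
    · simp only [untwist, Fin.mk_one, Matrix.cons_val_one, Matrix.cons_val_fin_one]
      rw [cauchyRiemann_mul ((contDiff_exp_pairK (-I)).differentiable (by simp) z) hd.snd, hsnd,
        cauchyRiemann_exp]
      refine (norm_add_le _ _).trans ?_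
      simp only [norm_mul _ (exp _), norm_mul (exp _), norm_mul _ (u z).1, norm_mul _ (u z).2, e2]
      have := hp (-I) (by simp)
      have h3 : ‖-I * α * U (-z)‖ ≤ M := by simpa using hM (-z)
      nlinarith [norm_nonneg (u z).1, norm_nonneg (u z).2]
  rw [n1, n2]
  calc _ ≤ (M * (‖(u z).1‖ + ‖(u z).2‖)) ^ 2 := by gcongr; exact key i
    _ ≤ _ := by nlinarith [mul_nonneg (sq_nonneg M) (sq_nonneg (‖(u z).1‖ - ‖(u z).2‖))]

lemma finite_kernel {U : ℂ → ℂ} (hU : IsTunnelling U) (α : ℂ) :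
    Module.Finite ℂ (kernel U α) := by
  obtain ⟨M₀, hM₀⟩ := exists_norm_le hU.1.continuous fun γ hγ z => by
    rw [hU.2.1 γ hγ, norm_mul, mul_comm I, norm_exp_ofReal_mul_I, one_mul]
  set M := max (‖α‖ * M₀) (4 * Real.pi / 3) with hMdef
  have hM (z : ℂ) : ‖α‖ * ‖U z‖ ≤ M :=
    (mul_le_mul_of_nonneg_left (hM₀ z) (norm_nonneg α)).trans (le_max_left _ _)
  have hM' : 4 * Real.pi / 3 ≤ M := le_max_right _ _
  have hMpos : 0 < M := lt_of_lt_of_le (by positivity) hM'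
  have := (finite_frequencies (4 * (2 * M ^ 2))).to_subtype
  let Φ : kernel U α →ₗ[ℂ]
      ({n : Fin 2 → ℤ | (n 0 : ℝ) ^ 2 + (n 1 : ℝ) ^ 2 ≤ 4 * (2 * M ^ 2)} → Fin 2 → ℂ) :=
    { toFun := fun u n i => latticeCoeff n (untwist u i)
      map_add' := fun u v => by
        funext n i
        rw [Pi.add_apply, Pi.add_apply, ← latticeCoeff_add n (contDiff_untwist u.2.1 i).continuous
          (contDiff_untwist v.2.1 i).continuous]
        congr 1
        funext z
        fin_cases i <;> simp [untwist] <;> ring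
      map_smul' := fun c u => by
        funext n i
        rw [RingHom.id_apply, Pi.smul_apply, Pi.smul_apply, smul_eq_mul, ← latticeCoeff_const_mul]
        congr 1
        funext z
        fin_cases i <;> simp [untwist] <;> ring }
  refine Module.Finite.of_injective Φ ((injective_iff_map_eq_zero Φ).2 fun u hu => ?_)
  have h0 := eq_zero_of_latticeCoeff_eq_zero (C := 2 * M ^ 2) (by positivity)
    (contDiff_untwist u.2.1) (fun i γ hγ z => untwist_add_of_mem u.2 i hγ z)
    (norm_cauchyRiemann_untwist_le u.2 hM hM') fun i n hn => congr_fun (congr_fun hu ⟨n, hn⟩) i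
  ext z : 2
  obtain ⟨n1, n2⟩ := norm_untwist u z
  rw [h0, Pi.zero_apply, norm_zero, eq_comm, norm_eq_zero] at n1 n2
  exact Prod.ext n1 n2

/-- A nonzero element of a space `Ker_p` of dimension at most one spans it. -/
lemma exists_eq_smul_of_kerPDim_le_one {U : ℂ → ℂ} (hU : IsTunnelling U) {α : ℂ} {p : ℕ}
    (hdim : kerPDim U (fun z => U (-z)) α p ≤ 1) {u v : ℂ → ℂ × ℂ}
    (hu : u ∈ kerPSet U (fun z => U (-z)) α p) (hv : v ∈ kerPSet U (fun z => U (-z)) α p)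
    (h0 : u ≠ 0) : ∃ c : ℂ, v = c • u := by
  have := finite_kernel hU α
  have hle := Submodule.span_le.2 (kerPSet_subset_kernel U α p)
  have hfin : Module.Finite ℂ (Submodule.span ℂ (kerPSet U (fun z => U (-z)) α p)) :=
    Submodule.finiteDimensional_of_le hle
  obtain ⟨w, hw⟩ := finrank_le_one_iff.1 hdim
  obtain ⟨a, ha⟩ := hw ⟨u, Submodule.subset_span hu⟩
  obtain ⟨b, hb⟩ := hw ⟨v, Submodule.subset_span hv⟩
  have ha' : a • (w : ℂ → ℂ × ℂ) = u := congr_arg Subtype.val ha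
  have hb' : b • (w : ℂ → ℂ × ℂ) = v := congr_arg Subtype.val hb
  have ha0 : a ≠ 0 := by
    rintro rfl
    exact h0 (by rw [← ha', zero_smul])
  refine ⟨b / a, ?_⟩
  rw [← ha', ← hb', smul_smul, div_mul_cancel₀ _ ha0]

end FourierKernel

section Zeros

variable {U : ℂ → ℂ} {α : ℂ} {p : ℕ} {u v : ℂ → ℂ × ℂ} {f : ℂ → ℂ}

lemma order_eq_top_of_smul_eq_const_smul (hf : ∀ z, MeromorphicAt f z) (hu : Continuous u)
    (h0 : u ≠ 0) {c : ℂ} (h : ∀ s, ∀ᶠ z in 𝓝[≠] s, c • u z = f z • u z) (s : ℂ) :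
    meromorphicOrderAt (fun z => f z - c) s = ⊤ := by
  obtain ⟨x, hx⟩ := Function.ne_iff.1 h0
  have hm (z : ℂ) : MeromorphicAt (fun z => f z - c) z := (hf z).sub (.const c z)
  by_contra hs
  refine order_ne_top_of_order_ne_top hm hs x (meromorphicOrderAt_eq_top_iff.2 ?_)
  filter_upwards [h x, nhdsWithin_le_nhds (hu.continuousAt.eventually_ne hx)] with z h1 h2
  exact sub_eq_zero.2 (smul_left_injective ℂ h2 h1).symm

lemma ne_zero_of_eventually_eq_smul (hf : ∀ z, MeromorphicAt f z) (hu : Continuous u)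
    (h0 : u ≠ 0) (h : ∀ s, ∀ᶠ z in 𝓝[≠] s, v z = f z • u z) {s : ℂ}
    (hs : meromorphicOrderAt f s ≠ ⊤) : v ≠ 0 := by
  rintro rfl
  exact hs (by
    simpa using order_eq_top_of_smul_eq_const_smul (c := 0) hf hu h0 (by simpa using h) s)

/-- The ratio of two elements of a one-dimensional `Ker_p` has neither zeros nor poles. -/
lemma order_eq_zero_of_eventually_eq_smul (hU : IsTunnelling U)
    (hdim : kerPDim U (fun z => U (-z)) α p ≤ 1) (hu : u ∈ kerPSet U (fun z => U (-z)) α p)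
    (hv : v ∈ kerPSet U (fun z => U (-z)) α p) (h0 : u ≠ 0) (hf : ∀ z, MeromorphicAt f z)
    (h : ∀ s, ∀ᶠ z in 𝓝[≠] s, v z = f z • u z) {s : ℂ} (hs : meromorphicOrderAt f s ≠ ⊤) :
    meromorphicOrderAt f s = 0 := by
  obtain ⟨c, rfl⟩ := exists_eq_smul_of_kerPDim_le_one hU hdim hu hv h0
  have h1 := meromorphicOrderAt_eq_top_iff.1
    (order_eq_top_of_smul_eq_const_smul (c := c) hf hu.1.1.continuous h0 h s)
  have h2 : f =ᶠ[𝓝[≠] s] fun _ => c := h1.mono fun z hz => sub_eq_zero.1 hz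
  rw [meromorphicOrderAt_congr h2] at hs ⊢
  exact order_eq_zero_of_ne_zero analyticAt_const fun hc =>
    hs (meromorphicOrderAt_eq_top_iff.2 (.of_forall fun _ => hc))

lemma wpd_sub_omega_mul (c z : ℂ) : (wpd (ω * z) - c)⁻¹ = ω ^ (-((0 : ℕ) : ℤ)) * (wpd z - c)⁻¹ := by
  simp [wpd_omega_mul]

lemma Vanish.omega_pow_mul {k : ℕ} (hu : u ∈ kerPSet U (fun z => U (-z)) α p) {s : ℂ}
    (h : Vanish u s k) (j : ℕ) : Vanish u (ω ^ j * s) k := by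
  induction j with
  | zero => simpa using h
  | succ j ih => simpa [pow_succ', mul_assoc] using ih.omega_mul hu

lemma apply_ne_zero_of_mem_lattice (hU : IsTunnelling U)
    (hdim : kerPDim U (fun z => U (-z)) α 0 ≤ 1) (hu : u ∈ kerPSet U (fun z => U (-z)) α 0)
    (h0 : u ≠ 0) {γ : ℂ} (hγ : γ ∈ Λ) : u γ ≠ 0 := by
  intro h
  have h1 : Vanish u 0 1 := vanish_one hU.1 hu (by
    simpa using apply_add_eq_zero hu h (neg_mem_lattice hγ))
  have h2 := h1.succ_zero hU.1 hu (by simpa using omega_ne_one)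
  have h3 := h2.succ_zero hU.1 hu (by simpa using omega_sq_ne_one)
  obtain ⟨v, hv, hvu⟩ := exists_mem_kerPSet_eq_smul hU.1 hu meromorphicAt_wpd
    (fun γ hγ z => wpd_add hγ z) wpd_omega_mul omega_ne_zero (r := 0) (by simp) fun s => by
      by_cases hs : s ∈ Λ
      · refine ⟨3, by simpa using h3.add_mem_lattice hu hs, ?_⟩
        rw [order_wpd hs]; rfl
      · exact ⟨0, vanish_zero hu.1.1 s, by
          simpa using (analyticAt_wpd hs).meromorphicOrderAt_nonneg⟩
  have := order_eq_zero_of_eventually_eq_smul hU hdim hu hv h0 meromorphicAt_wpd hvu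
    (order_wpd_ne_top 0)
  rw [order_wpd zero_mem_lattice] at this
  exact absurd (WithTop.coe_eq_zero.1 this) (by norm_num)

lemma mem_stacking_of_apply_eq_zero (hU : IsTunnelling U)
    (hdim : kerPDim U (fun z => U (-z)) α 0 ≤ 1) (hu : u ∈ kerPSet U (fun z => U (-z)) α 0)
    (h0 : u ≠ 0) {a : ℂ} (h : u a = 0) : a ∈ stacking := by
  by_contra ha
  have haL : a ∉ Λ := fun h1 => apply_ne_zero_of_mem_lattice hU hdim hu h0 h1 h
  have hwp : wp a ≠ 0 := fun h1 => ha (mem_stacking_of_wp_eq_zero haL h1)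
  set c := wpd a with hc
  have hm (s : ℂ) : MeromorphicAt (fun z => (wpd z - c)⁻¹) s := (meromorphicAt_wpd_sub c s).inv
  have ho (s : ℂ) : meromorphicOrderAt (fun z => (wpd z - c)⁻¹) s =
      -meromorphicOrderAt (fun z => wpd z - c) s :=
    meromorphicOrderAt_inv (f := fun z => wpd z - c)
  have hΛ {s : ℂ} (hs : s ∈ Λ) :
      meromorphicOrderAt (fun z => (wpd z - c)⁻¹) s = ((3 : ℤ) : WithTop ℤ) := by
    rw [ho, order_wpd_sub c hs, ← WithTop.LinearOrderedAddCommGroup.coe_neg]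
    rfl
  obtain ⟨v, hv, hvu⟩ := exists_mem_kerPSet_eq_smul hU.1 hu hm
    (fun γ hγ z => by rw [wpd_add hγ z]) (wpd_sub_omega_mul c) omega_ne_zero (r := 0) (by simp)
    fun s => by
      by_cases hs : s ∈ Λ
      · exact ⟨0, vanish_zero hu.1.1 s, by
          rw [hΛ hs]
          exact WithTop.coe_le_coe.2 (by norm_num : (-((0 : ℕ) : ℤ)) ≤ 3)⟩
      · rw [ho]
        by_cases hsc : wpd s = c
        · obtain ⟨j, hj⟩ := eq_or_of_wpd_eq haL hs hsc.symm
          have h1 := ((vanish_one hU.1 hu h).omega_pow_mul hu j).add_mem_lattice hu hj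
          refine ⟨1, by simpa using h1, ?_⟩
          rw [order_wpd_sub_of_eq hs hsc fun h2 => hwp ?_]
          · exact_mod_cast le_rfl
          · have h3 := wpd_sq haL
            have h4 := wpd_sq hs
            rw [h2, hsc] at h4
            rw [← hc] at h3
            exact (pow_eq_zero_iff three_ne_zero).1 (by linear_combination (h4 - h3) / 4)
        · exact ⟨0, vanish_zero hu.1.1 s, by rw [order_wpd_sub_of_ne hs hsc]; simp⟩
  have := order_eq_zero_of_eventually_eq_smul hU hdim hu hv h0 hm hvu (s := 0)
    (by rw [hΛ zero_mem_lattice]; exact WithTop.coe_ne_top)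
  rw [hΛ zero_mem_lattice] at this
  exact absurd (WithTop.coe_eq_zero.1 this) (by norm_num)

lemma apply_eq_zero_iff_mem_stacking (hU : IsTunnelling U)
    (hdim : kerPDim U (fun z => U (-z)) α 0 ≤ 1) (hu : u ∈ kerPSet U (fun z => U (-z)) α 0)
    (h0 : u ≠ 0) (z : ℂ) : u z = 0 ↔ z ∈ stacking := by
  refine ⟨mem_stacking_of_apply_eq_zero hU hdim hu h0, ?_⟩
  rintro (h | h)
  · simpa using apply_add_eq_zero hu (apply_zS_eq_zero hu) h
  · simpa using apply_add_eq_zero hu (apply_neg_zS_eq_zero hu) h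

lemma vanish_neg (hU : IsTunnelling U) (hdim : kerPDim U (fun z => U (-z)) α p ≤ 1)
    (hu : u ∈ kerPSet U (fun z => U (-z)) α p) (h0 : u ≠ 0) {s : ℂ} {k : ℕ} (h : Vanish u s k) :
    Vanish u (-s) k := by
  obtain ⟨c, hc⟩ :=
    exists_eq_smul_of_kerPDim_le_one hU hdim (flip_mem_kerPSet hu) hu (flip_ne_zero h0)
  obtain ⟨w, hw, hwu⟩ := vanish_flip h
  refine ⟨fun z => c • w z, hw.const_smul c, fun z => ?_⟩
  rw [congr_fun hc z, Pi.smul_apply, hwu, smul_comm]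

lemma vanish_of_mem_stacking (hU : IsTunnelling U) (hdim : kerPDim U (fun z => U (-z)) α p ≤ 1)
    (hu : u ∈ kerPSet U (fun z => U (-z)) α p) (h0 : u ≠ 0) {s t : ℂ} {k : ℕ} (h : Vanish u s k)
    (hs : s ∈ stacking) (ht : t ∈ stacking) : Vanish u t k := by
  have : t - s ∈ Λ ∨ t + s ∈ Λ := by
    rcases hs with hs | hs <;> rcases ht with ht | ht
    · exact .inl (by simpa using sub_mem_lattice ht hs)
    · exact .inr (by simpa using add_mem_lattice ht hs)
    · exact .inr (by simpa using add_mem_lattice ht hs)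
    · exact .inl (by simpa using sub_mem_lattice ht hs)
  rcases this with hts | hts
  · simpa using h.add_mem_lattice hu hts
  · simpa using (vanish_neg hU hdim hu h0 h).add_mem_lattice hu hts

lemma order_inv_wp_sq (s : ℂ) : meromorphicOrderAt (fun z => (wp z ^ 2)⁻¹) s =
    -(2 * meromorphicOrderAt wp s) := by
  have h := meromorphicOrderAt_inv (f := fun z => wp z ^ 2) (x := s)
  have h2 : (fun z => wp z ^ 2) = wp ^ 2 := rfl
  rw [h2, meromorphicOrderAt_pow (meromorphicAt_wp s)] at h
  exact h

lemma not_vanish_two (hU : IsTunnelling U) (hdim : kerPDim U (fun z => U (-z)) α 0 ≤ 1)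
    (hdim2 : kerPDim U (fun z => U (-z)) α 2 ≤ 1) (hu : u ∈ kerPSet U (fun z => U (-z)) α 0)
    (h0 : u ≠ 0) {s : ℂ} (hs : s ∈ stacking) : ¬Vanish u s 2 := by
  intro h
  have hm (s : ℂ) : MeromorphicAt (fun z => (wp z ^ 2)⁻¹) s := ((meromorphicAt_wp s).pow 2).inv
  have hm2 (s : ℂ) : MeromorphicAt (fun z => wpd z * (wp z ^ 2)⁻¹) s :=
    (meromorphicAt_wpd s).mul (hm s)
  have hmul (s : ℂ) : meromorphicOrderAt (fun z => wpd z * (wp z ^ 2)⁻¹) s =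
      meromorphicOrderAt wpd s + meromorphicOrderAt (fun z => (wp z ^ 2)⁻¹) s :=
    meromorphicOrderAt_mul (meromorphicAt_wpd s) (hm s)
  have hper {γ : ℂ} (hγ : γ ∈ Λ) (z : ℂ) : (wp (z + γ) ^ 2)⁻¹ = (wp z ^ 2)⁻¹ := by rw [wp_add hγ]
  have hrot (z : ℂ) : (wp (ω * z) ^ 2)⁻¹ = ω ^ (-((2 : ℕ) : ℤ)) * (wp z ^ 2)⁻¹ := by
    have h6 : ω ^ 4 = (ω ^ 2)⁻¹ :=
      eq_inv_of_mul_eq_one_left (by linear_combination (ω ^ 3 + 1) * omega_pow_three)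
    rw [wp_omega_mul, mul_pow, mul_inv, zpow_neg, zpow_natCast, inv_pow, inv_inv, ← h6]
    ring
  have hΛ {s : ℂ} (hs : s ∈ Λ) :
      meromorphicOrderAt (fun z => (wp z ^ 2)⁻¹) s = ((4 : ℤ) : WithTop ℤ) := by
    rw [order_inv_wp_sq, order_wp hs]
    rfl
  have hst {s : ℂ} (hs : s ∈ stacking) :
      meromorphicOrderAt (fun z => (wp z ^ 2)⁻¹) s = ((-2 : ℤ) : WithTop ℤ) := by
    rw [order_inv_wp_sq, order_wp_of_mem_stacking hs]
    rfl
  have hst2 {s : ℂ} (hs : s ∉ Λ) (hs2 : s ∉ stacking) :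
      meromorphicOrderAt (fun z => (wp z ^ 2)⁻¹) s = 0 := by
    rw [order_inv_wp_sq, order_eq_zero_of_ne_zero (analyticAt_wp hs) fun h =>
      hs2 (mem_stacking_of_wp_eq_zero hs h)]
    rfl
  obtain ⟨v₁, hv₁, hvu₁⟩ := exists_mem_kerPSet_eq_smul hU.1 hu hm (fun γ hγ z => hper hγ z) hrot
    omega_ne_zero (r := 2) (by simp) fun t => by
      by_cases ht : t ∈ Λ
      · exact ⟨0, vanish_zero hu.1.1 t, by
          rw [hΛ ht]
          exact WithTop.coe_le_coe.2 (by norm_num : (-((0 : ℕ) : ℤ)) ≤ 4)⟩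
      · by_cases ht2 : t ∈ stacking
        · exact ⟨2, vanish_of_mem_stacking hU hdim hu h0 h hs ht2, by rw [hst ht2]; rfl⟩
        · exact ⟨0, vanish_zero hu.1.1 t, by rw [hst2 ht ht2]; simp⟩
  obtain ⟨v₂, hv₂, hvu₂⟩ := exists_mem_kerPSet_eq_smul hU.1 hu hm2
    (fun γ hγ z => by rw [hper hγ, wpd_add hγ]) (q := 2)
    (fun z => by rw [hrot, wpd_omega_mul]; simp; ring)
    omega_ne_zero (r := 2) (by simp) fun t => by
      rw [hmul]
      by_cases ht : t ∈ Λ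
      · exact ⟨0, vanish_zero hu.1.1 t, by
          rw [hΛ ht, order_wpd ht, ← WithTop.coe_add]
          exact_mod_cast (by norm_num : (0 : ℤ) ≤ -3 + 4)⟩
      · by_cases ht2 : t ∈ stacking
        · exact ⟨2, vanish_of_mem_stacking hU hdim hu h0 h hs ht2, by
            rw [hst ht2, order_eq_zero_of_ne_zero (analyticAt_wpd ht)
              (wpd_ne_zero_of_wp_eq_zero ht (wp_eq_zero_of_mem_stacking ht2)), zero_add]
            rfl⟩
        · exact ⟨0, vanish_zero hu.1.1 t, by
            rw [hst2 ht ht2]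
            simpa using (analyticAt_wpd ht).meromorphicOrderAt_nonneg⟩
  have hv₁0 : v₁ ≠ 0 := ne_zero_of_eventually_eq_smul hm hu.1.1.continuous h0 hvu₁ (s := 0)
    (by rw [hΛ zero_mem_lattice]; exact WithTop.coe_ne_top)
  have := order_eq_zero_of_eventually_eq_smul hU hdim2 hv₁ hv₂ hv₁0 meromorphicAt_wpd
    (fun s => by
      filter_upwards [hvu₁ s, hvu₂ s] with z h1 h2
      rw [h2, h1, smul_smul])
    (order_wpd_ne_top 0)
  rw [order_wpd zero_mem_lattice] at this
  exact absurd (WithTop.coe_eq_zero.1 this) (by norm_num)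

/-- Multiplication by `wp` carries `Ker₁` to `Ker₀`. -/
lemma exists_mem_kerPSet_zero_eq_wp_smul (hU : IsTunnelling U)
    (hu : u ∈ kerPSet U (fun z => U (-z)) α 1) (h2 : ∀ γ ∈ Λ, Vanish u γ 2) :
    ∃ v ∈ kerPSet U (fun z => U (-z)) α 0, ∀ s, ∀ᶠ z in 𝓝[≠] s, v z = wp z • u z :=
  exists_mem_kerPSet_eq_smul hU.1 hu meromorphicAt_wp (fun γ hγ z => wp_add hγ z) wp_omega_mul
    omega_ne_zero (r := 0)
    (by
      rw [← zpow_add₀ omega_ne_zero]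
      norm_num
      exact omega_pow_three)
    fun s => by
      by_cases hs : s ∈ Λ
      · exact ⟨2, h2 s hs, by rw [order_wp hs]; rfl⟩
      · exact ⟨0, vanish_zero hu.1.1 s, by simpa using (analyticAt_wp hs).meromorphicOrderAt_nonneg⟩

lemma vanish_two_of_mem_lattice (hU : IsTunnelling U) (hu : u ∈ kerPSet U (fun z => U (-z)) α 1)
    {γ : ℂ} (hγ : γ ∈ Λ) : Vanish u γ 2 := by
  have h1 := (vanish_zero hu.1.1 0).succ_zero hU.1 hu (by simpa using omega_ne_one)
  have h2 := h1.succ_zero hU.1 hu (by simpa using omega_sq_ne_one)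
  simpa using h2.add_mem_lattice hu hγ

lemma continuousAt_wp {z : ℂ} (hz : z ∉ Λ) : ContinuousAt wp z := (analyticAt_wp hz).continuousAt

lemma apply_eq_wp_smul {z : ℂ} (hz : z ∉ Λ) (hu : Continuous u) (hv : Continuous v)
    (h : ∀ᶠ y in 𝓝[≠] z, v y = wp y • u y) : v z = wp z • u z :=
  tendsto_nhds_unique (hv.continuousAt.mono_left nhdsWithin_le_nhds)
    ((((continuousAt_wp hz).smul hu.continuousAt).mono_left nhdsWithin_le_nhds).congr'
      (h.mono fun _ hy => hy.symm))

lemma not_vanish_three {γ : ℂ} (hγ : γ ∈ Λ) (hv : Continuous v) (hvγ : v γ ≠ 0)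
    (h : ∀ᶠ z in 𝓝[≠] γ, v z = wp z • u z) : ¬Vanish u γ 3 := by
  rintro ⟨w, hw, hwu⟩
  have hm : MeromorphicAt (fun z => (z - γ) ^ 3) γ := by fun_prop
  have ho : 0 < meromorphicOrderAt (wp * fun z => (z - γ) ^ 3) γ := by
    have h1 : meromorphicOrderAt (fun z : ℂ => (z - γ) ^ 3) γ = (3 : ℤ) :=
      (meromorphicOrderAt_eq_int_iff hm).2 ⟨1, analyticAt_const, by simp, by simp⟩
    rw [meromorphicOrderAt_mul (meromorphicAt_wp γ) hm, h1, order_wp hγ]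
    exact WithTop.coe_lt_coe.2 (by norm_num : (0 : ℤ) < -2 + 3)
  refine hvγ (tendsto_nhds_unique (l := 𝓝[≠] γ) (hv.continuousAt.mono_left nhdsWithin_le_nhds) ?_)
  have h3 := (tendsto_zero_of_meromorphicOrderAt_pos ho).smul
    ((hw.continuous.tendsto γ).mono_left nhdsWithin_le_nhds)
  rw [zero_smul] at h3
  refine h3.congr' (h.mono fun z hz => ?_)
  rw [hz, hwu, smul_smul, Pi.mul_apply]

lemma vanish_two_of_eq_wp_smul (hU : IsTunnelling U) (hu : u ∈ kerPSet U (fun z => U (-z)) α 1)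
    (hv : v ∈ kerPSet U (fun z => U (-z)) α 0) {s : ℂ} (hs : s ∈ stacking) (hus : u s = 0)
    (h : ∀ z, z ∉ Λ → v z = wp z • u z) : Vanish v s 2 := by
  have hsΛ := not_mem_lattice_of_mem_stacking hs
  obtain ⟨w, hw, hwv⟩ := vanish_one hU.1 hv
    (show v s = 0 by rw [h s hsΛ, hus, smul_zero])
  obtain ⟨w', hw', hwu⟩ := vanish_one hU.1 hu hus
  have h1 : w s = wp s • w' s := by
    refine apply_eq_wp_smul hsΛ hw'.continuous hw.continuous ?_
    filter_upwards [self_mem_nhdsWithin, nhdsWithin_le_nhds (isOpen_compl_lattice.mem_nhds hsΛ)]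
      with z hzs hz
    have h2 := h z hz
    rw [hwv, hwu, pow_one, smul_comm] at h2
    exact smul_right_injective _ (sub_ne_zero.2 hzs) h2
  exact Vanish.succ hU.1 hv hw hwv (by rw [h1, wp_eq_zero_of_mem_stacking hs, zero_smul])

end Zeros

end

/-- **exact location and order of zeros.**
Under the assumption `dim Ker_p(α) ≤ 1` for all `p ∈ {0,1,2}`:
(a) a nonzero `u ∈ Ker₀(α)` vanishes exactly on `(z_S + Λ) ∪ (−z_S + Λ)`, with simple zeros;
(b) a nonzero `u ∈ Ker₁(α)` vanishes exactly on `Λ`, with zeros of order exactly two. -/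
theorem zeros_exact (U : ℂ → ℂ) (hU : IsTunnelling U) (α : ℂ)
    (hdim : ∀ p : ℕ, p < 3 → kerPDim U (fun z => U (-z)) α p ≤ 1) :
    (∀ u ∈ kerPSet U (fun z => U (-z)) α 0, u ≠ 0 →
      (∀ z : ℂ, u z = 0 ↔ (z - zS ∈ Λ ∨ z + zS ∈ Λ)) ∧
      (∀ z₀ : ℂ, (z₀ - zS ∈ Λ ∨ z₀ + zS ∈ Λ) →
        ∃ w : ℂ → ℂ × ℂ, ContDiff ℝ (⊤ : ℕ∞) w ∧ (∀ z : ℂ, u z = (z - z₀) • w z) ∧ w z₀ ≠ 0)) ∧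
    (∀ u ∈ kerPSet U (fun z => U (-z)) α 1, u ≠ 0 →
      (∀ z : ℂ, u z = 0 ↔ z ∈ Λ) ∧
      (∀ γ ∈ Λ, ∃ w : ℂ → ℂ × ℂ, ContDiff ℝ (⊤ : ℕ∞) w ∧
        (∀ z : ℂ, u z = ((z - γ) ^ 2) • w z) ∧ w γ ≠ 0)) := by
  have hd0 := hdim 0 (by norm_num)
  have hd2 := hdim 2 (by norm_num)
  refine ⟨fun u hu h0 => ⟨apply_eq_zero_iff_mem_stacking hU hd0 hu h0, fun s hs => ?_⟩,
    fun u hu h0 => ?_⟩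
  · obtain ⟨w, hw, hwu⟩ := vanish_one hU.1 hu
      ((apply_eq_zero_iff_mem_stacking hU hd0 hu h0 s).2 hs)
    exact ⟨w, hw, fun z => by rw [hwu, pow_one], fun hws =>
      not_vanish_two hU hd0 hd2 hu h0 hs (Vanish.succ hU.1 hu hw hwu hws)⟩
  · have hΛ {γ : ℂ} (hγ : γ ∈ Λ) : Vanish u γ 2 := vanish_two_of_mem_lattice hU hu hγ
    obtain ⟨v, hv, hvu⟩ := exists_mem_kerPSet_zero_eq_wp_smul hU hu fun γ hγ => hΛ hγ
    have hv0 : v ≠ 0 := ne_zero_of_eventually_eq_smul meromorphicAt_wp hu.1.1.continuous h0 hvu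
      (s := 0) (by rw [order_wp zero_mem_lattice]; exact WithTop.coe_ne_top)
    have hvz {z : ℂ} (hz : z ∉ Λ) : v z = wp z • u z :=
      apply_eq_wp_smul hz hu.1.1.continuous hv.1.1.continuous (hvu z)
    refine ⟨fun z => ⟨fun hz => ?_, fun hz => (hΛ hz).apply_eq_zero two_ne_zero⟩, fun γ hγ => ?_⟩
    · by_contra hzΛ
      have hzs := (apply_eq_zero_iff_mem_stacking hU hd0 hv hv0 z).1
        (by rw [hvz hzΛ, hz, smul_zero])
      exact not_vanish_two hU hd0 hd2 hv hv0 hzs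
        (vanish_two_of_eq_wp_smul hU hu hv hzs hz fun z hz => hvz hz)
    · obtain ⟨w, hw, hwu⟩ := hΛ hγ
      exact ⟨w, hw, hwu, fun hwγ => not_vanish_three hγ hv.1.1.continuous
        (apply_ne_zero_of_mem_lattice hU hd0 hv hv0 hγ) (hvu γ) (Vanish.succ hU.1 hu hw hwu hwγ)⟩

end TBG
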